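/- arXiv:1107.3359 — 3 statements merged into one kernel-verified Lean document; each statement's English description precedes it below -/
import Mathlib

section
/- Let I ⊂ S = K[x_1,…,x_n] be a monomial ideal minimally generated by m monomials, and suppose there exists an associated prime P ∈ Ass(S/I) with height(P) = m. Then sdepth_S(S/I) = n − m. -/
open MvPolynomial

/-- The `K`-subspace `m·K[Z]` of `S = K[x_0,…,x_{n-1}]`, where `m` is the monomial with
exponent vector `a` and `Z` is a set of variables: the span of all monomials `m·w`
with `w` a monomial in the variables of `Z`. -/
noncomputable def StanleySpace (K : Type*) [Field K] {n : ℕ} (a : Fin n →₀ ℕ)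
    (Z : Finset (Fin n)) : Submodule K (MvPolynomial (Fin n) K) :=
  Submodule.span K
    {p | ∃ c : Fin n →₀ ℕ, c.support ⊆ Z ∧ p = monomial (a + c) (1 : K)}

/-- `I` is a monomial ideal, i.e. an ideal generated by monomials. -/
def IsMonomialIdeal {K : Type*} [Field K] {n : ℕ}
    (I : Ideal (MvPolynomial (Fin n) K)) : Prop :=
  ∃ G : Set (Fin n →₀ ℕ), I = Ideal.span ((fun a => monomial a (1 : K)) '' G)

/-- The `K`-subspace of `S` spanned by the monomials lying in `I` but not in `J`.
For monomial ideals `J ⊆ I` this is the canonical `K`-vector space representative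
of the `ℤⁿ`-graded module `I/J` inside `S`. -/
noncomputable def monomialSpan (K : Type*) [Field K] {n : ℕ}
    (I J : Ideal (MvPolynomial (Fin n) K)) : Submodule K (MvPolynomial (Fin n) K) :=
  Submodule.span K
    {p | ∃ a : Fin n →₀ ℕ, p = monomial a (1 : K) ∧
      monomial a (1 : K) ∈ I ∧ monomial a (1 : K) ∉ J}

/-- The family `(a i, Z i), i = 1,…,r` is a Stanley decomposition of the module `I/J`
(represented by the span of the monomials of `I \ J`): the Stanley spaces
`(a i)·K[Z i]` are independent and their (direct) sum is all of `I/J`. -/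
def IsStanleyDecomp (K : Type*) [Field K] {n r : ℕ}
    (I J : Ideal (MvPolynomial (Fin n) K))
    (a : Fin r → (Fin n →₀ ℕ)) (Z : Fin r → Finset (Fin n)) : Prop :=
  iSupIndep (fun i => StanleySpace K (a i) (Z i)) ∧
    (⨆ i, StanleySpace K (a i) (Z i)) = monomialSpan K I J

/-- The Stanley depth `sdepth_S (I/J)` of the module `I/J`, where `J ⊆ I ⊆ S` are
monomial ideals: the largest `d` such that there is a Stanley decomposition of `I/J`
all of whose Stanley spaces use at least `d` variables.  (As `ℕ∞`: the Stanley depth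
of the zero module, which admits the empty decomposition, is `⊤`.)
`sdepth K I ⊥` is `sdepth_S I` and `sdepth K ⊤ I` is `sdepth_S (S/I)`. -/
noncomputable def sdepth (K : Type*) [Field K] {n : ℕ}
    (I J : Ideal (MvPolynomial (Fin n) K)) : ℕ∞ :=
  sSup {d : ℕ∞ | ∃ (r : ℕ) (a : Fin r → (Fin n →₀ ℕ)) (Z : Fin r → Finset (Fin n)),
    IsStanleyDecomp K I J a Z ∧ ∀ i, d ≤ ((Z i).card : ℕ∞)}

/-- The depth `depth_S M` of an `S`-module `M` with respect to the maximal graded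
ideal `(x_0,…,x_{n-1})`: the supremum of the lengths of `M`-regular sequences
contained in that ideal. -/
noncomputable def gradedDepth (K : Type*) [Field K] (n : ℕ) (M : Type*)
    [AddCommGroup M] [Module (MvPolynomial (Fin n) K) M] : ℕ∞ :=
  sSup {k : ℕ∞ | ∃ rs : List (MvPolynomial (Fin n) K), (rs.length : ℕ∞) = k ∧
    (∀ x ∈ rs, x ∈ Ideal.span (Set.range (X : Fin n → MvPolynomial (Fin n) K))) ∧
    RingTheory.Sequence.IsRegular M rs}

/-- Extension of an ideal along an inclusion of polynomial rings induced by a map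
of variables (`IS`, for `f` injective). -/
noncomputable def extIdeal {K : Type*} [Field K] {m n : ℕ} (f : Fin m → Fin n)
    (I : Ideal (MvPolynomial (Fin m) K)) : Ideal (MvPolynomial (Fin n) K) :=
  Ideal.map (rename f : MvPolynomial (Fin m) K →ₐ[K] MvPolynomial (Fin n) K) I

/-- The inclusion of the variables of `S'' = K[x_{r+1},…,x_n]` into those of
`S = K[x_1,…,x_n]` (variables indexed from `0`). -/
def sndEmbed {n r : ℕ} (h : r ≤ n) : Fin (n - r) → Fin n :=
  fun i => ⟨r + i.1, by have := i.2; omega⟩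

/-- The inclusion of the variables of `S'' = K[x_s,…,x_n]` into those of
`S = K[x_1,…,x_n]` (variables indexed from `0`). -/
def midEmbed {n s : ℕ} (hs : 1 ≤ s) (hsn : s ≤ n) : Fin (n + 1 - s) → Fin n :=
  fun i => ⟨s - 1 + i.1, by have := i.2; omega⟩

/-- The exponent vectors of the monomials of the Stanley space `StanleySpace K a Z`. -/
def stanleyCell {n : ℕ} (a : Fin n →₀ ℕ) (Z : Finset (Fin n)) : Set (Fin n →₀ ℕ) :=
  {b | ∃ c : Fin n →₀ ℕ, c.support ⊆ Z ∧ b = a + c}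

/-- The sets of exponent vectors that are finite disjoint unions of cells `stanleyCell a Z`
with at least `d` free variables each. -/
inductive StanleyPartitionable {n : ℕ} (d : ℕ) : Set (Fin n →₀ ℕ) → Prop
  | empty : StanleyPartitionable d ∅
  | cell (a : Fin n →₀ ℕ) (Z : Finset (Fin n)) (hZ : d ≤ Z.card) :
      StanleyPartitionable d (stanleyCell a Z)
  | union {A B : Set (Fin n →₀ ℕ)} (hA : StanleyPartitionable d A)
      (hB : StanleyPartitionable d B) (hAB : Disjoint A B) : StanleyPartitionable d (A ∪ B)

theorem mem_stanleyCell_iff {n : ℕ} {a b : Fin n →₀ ℕ} {Z : Finset (Fin n)} :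
    b ∈ stanleyCell a Z ↔ a ≤ b ∧ ∀ i ∉ Z, b i = a i := by
  constructor
  · rintro ⟨c, hc, rfl⟩
    refine ⟨le_self_add, fun i hi => ?_⟩
    have : c i = 0 := Finsupp.notMem_support_iff.1 fun h => hi (hc h)
    simp [this]
  · rintro ⟨hab, h⟩
    refine ⟨b - a, fun i hi => ?_, (add_tsub_cancel_of_le hab).symm⟩
    by_contra hiZ
    simp [h i hiZ] at hi

theorem stanleyCell_eq_union_erase {n : ℕ} (a : Fin n →₀ ℕ) {Z : Finset (Fin n)} {k : Fin n}
    (hk : k ∈ Z) :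
    stanleyCell a Z =
      stanleyCell a (Z.erase k) ∪ stanleyCell (a + Finsupp.single k 1) Z := by
  ext b
  simp only [Set.mem_union, mem_stanleyCell_iff, Finsupp.le_def, Finset.mem_erase,
    Finsupp.add_apply, Finsupp.single_apply]
  grind

theorem disjoint_stanleyCell_erase {n : ℕ} (a : Fin n →₀ ℕ) (Z : Finset (Fin n)) (k : Fin n) :
    Disjoint (stanleyCell a (Z.erase k)) (stanleyCell (a + Finsupp.single k 1) Z) := by
  refine Set.disjoint_left.2 fun b hb hb' => ?_
  have h1 := (mem_stanleyCell_iff.1 hb).2 k (Finset.notMem_erase k Z)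
  have h2 := (mem_stanleyCell_iff.1 hb').1 k
  simp only [Finsupp.add_apply, Finsupp.single_eq_same] at h2
  omega

/-- Removing a principal up-set from a cell costs at most one free variable. -/
theorem stanleyPartitionable_stanleyCell_diff_Ici {n d : ℕ} (u a : Fin n →₀ ℕ)
    (Z : Finset (Fin n)) (hZ : d + 1 ≤ Z.card) :
    StanleyPartitionable d (stanleyCell a Z \ Set.Ici u) := by
  induction hN : ∑ i, (u i - a i) using Nat.strong_induction_on generalizing a with
  | _ N ih =>
  by_cases hua : u ≤ a
  · convert StanleyPartitionable.empty
    rw [Set.sdiff_eq_empty]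
    exact fun b hb => hua.trans (mem_stanleyCell_iff.1 hb).1
  obtain ⟨k, hk⟩ : ∃ k, a k < u k := by
    simpa [Finsupp.le_def] using hua
  have key : ∀ W : Finset (Fin n), k ∉ W → stanleyCell a W \ Set.Ici u = stanleyCell a W := by
    refine fun W hW => (Set.disjoint_left.2 fun b hb hb' => ?_).sdiff_eq_left
    have h1 := (mem_stanleyCell_iff.1 hb).2 k hW
    have h2 : u k ≤ b k := (Set.mem_Ici.1 hb') k
    omega
  by_cases hkZ : k ∈ Z
  · rw [stanleyCell_eq_union_erase a hkZ, Set.union_sdiff_distrib, key _ (Finset.notMem_erase k Z)]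
    refine .union (.cell _ _ ?_) (ih _ ?_ _ rfl)
      ((disjoint_stanleyCell_erase a Z k).mono_right Set.sdiff_subset)
    · rw [Finset.card_erase_of_mem hkZ]
      omega
    · rw [← hN]
      refine Finset.sum_lt_sum (fun i _ => ?_) ⟨k, Finset.mem_univ k, ?_⟩
      · simp only [Finsupp.add_apply]
        omega
      · simp only [Finsupp.add_apply, Finsupp.single_eq_same]
        omega
  · rw [key Z hkZ]
    exact .cell _ _ (by omega)

theorem StanleyPartitionable.diff_Ici {n d : ℕ} {A : Set (Fin n →₀ ℕ)}
    (hA : StanleyPartitionable (d + 1) A) (u : Fin n →₀ ℕ) :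
    StanleyPartitionable d (A \ Set.Ici u) := by
  induction hA with
  | empty => simpa using StanleyPartitionable.empty
  | cell a Z hZ => exact stanleyPartitionable_stanleyCell_diff_Ici u a Z hZ
  | union _ _ hAB ihA ihB =>
    rw [Set.union_sdiff_distrib]
    exact .union ihA ihB (hAB.mono Set.sdiff_subset Set.sdiff_subset)

/-- The complement of an up-set with generating set `G` is a disjoint union of cells with at
least `n - |G|` free variables. -/
theorem stanleyPartitionable_compl_upperClosure {n d : ℕ} (G : Finset (Fin n →₀ ℕ))
    (hG : G.card + d ≤ n) : StanleyPartitionable d {a | ∀ u ∈ G, ¬ u ≤ a} := by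
  induction G using Finset.induction_on generalizing d with
  | empty =>
    convert StanleyPartitionable.cell (0 : Fin n →₀ ℕ) Finset.univ (d := d) (by simpa using hG)
    ext b
    simp [mem_stanleyCell_iff]
  | insert u G hu ih =>
    rw [Finset.card_insert_of_notMem hu] at hG
    convert (ih (d := d + 1) (by omega)).diff_Ici u
    ext b
    simp [and_comm]

theorem StanleyPartitionable.exists_family {n d : ℕ} {A : Set (Fin n →₀ ℕ)}
    (hA : StanleyPartitionable d A) :
    ∃ (r : ℕ) (a : Fin r → (Fin n →₀ ℕ)) (Z : Fin r → Finset (Fin n)),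
      Pairwise (fun i j => Disjoint (stanleyCell (a i) (Z i)) (stanleyCell (a j) (Z j))) ∧
      (⋃ i, stanleyCell (a i) (Z i)) = A ∧ ∀ i, d ≤ (Z i).card := by
  induction hA with
  | empty => exact ⟨0, Fin.elim0, Fin.elim0, fun i => i.elim0, by simp, fun i => i.elim0⟩
  | cell a Z hZ =>
    exact ⟨1, fun _ => a, fun _ => Z, fun i j hij => (hij (Subsingleton.elim i j)).elim,
      by simp [Set.iUnion_const], fun _ => hZ⟩
  | union _ _ hAB ihA ihB =>
    obtain ⟨r, a, Z, hd, rfl, hc⟩ := ihA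
    obtain ⟨s, b, W, hd', rfl, hc'⟩ := ihB
    have hcross : ∀ i j, Disjoint (stanleyCell (a i) (Z i)) (stanleyCell (b j) (W j)) :=
      fun i j => hAB.mono (Set.subset_iUnion (fun i => stanleyCell (a i) (Z i)) i)
        (Set.subset_iUnion (fun j => stanleyCell (b j) (W j)) j)
    refine ⟨r + s, Fin.append a b, Fin.append Z W, fun i j => ?_, ?_, fun i => ?_⟩
    · refine Fin.addCases (fun i => ?_) (fun i => ?_) i <;>
        refine Fin.addCases (fun j => ?_) (fun j => ?_) j <;> intro hij
      · simpa using hd fun h => hij (congrArg _ h)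
      · simpa using hcross i j
      · simpa using (hcross j i).symm
      · simpa using hd' fun h => hij (congrArg _ h)
    · ext x
      simp only [Set.mem_iUnion, Set.mem_union]
      constructor
      · rintro ⟨i, hi⟩
        induction i using Fin.addCases with
        | left i => exact Or.inl ⟨i, by simpa using hi⟩
        | right i => exact Or.inr ⟨i, by simpa using hi⟩
      · rintro (⟨i, hi⟩ | ⟨i, hi⟩)
        · exact ⟨Fin.castAdd s i, by simpa using hi⟩
        · exact ⟨Fin.natAdd r i, by simpa using hi⟩
    · induction i using Fin.addCases with
      | left i => simpa using hc i
      | right i => simpa using hc' i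

section Algebra

variable {K : Type*} [Field K] {n : ℕ}

theorem linearIndependent_monomial_one :
    LinearIndependent K (fun a : Fin n →₀ ℕ => monomial a (1 : K)) := by
  simpa using (basisMonomials (Fin n) K).linearIndependent

theorem stanleySpace_eq_span (a : Fin n →₀ ℕ) (Z : Finset (Fin n)) :
    StanleySpace K a Z =
      Submodule.span K ((fun b => monomial b (1 : K)) '' stanleyCell a Z) := by
  unfold StanleySpace
  congr 1
  ext p
  constructor
  · rintro ⟨c, hc, rfl⟩
    exact ⟨a + c, ⟨c, hc, rfl⟩, rfl⟩
  · rintro ⟨_, ⟨c, hc, rfl⟩, rfl⟩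
    exact ⟨c, hc, rfl⟩

theorem monomialSpan_top_eq_span (I : Ideal (MvPolynomial (Fin n) K)) :
    monomialSpan K ⊤ I =
      Submodule.span K ((fun b => monomial b (1 : K)) '' {b | monomial b (1 : K) ∉ I}) := by
  unfold monomialSpan
  congr 1
  ext p
  constructor
  · rintro ⟨a, rfl, -, ha⟩
    exact ⟨a, ha, rfl⟩
  · rintro ⟨a, ha, rfl⟩
    exact ⟨a, rfl, trivial, ha⟩

theorem iSup_stanleySpace {r : ℕ} (a : Fin r → (Fin n →₀ ℕ)) (Z : Fin r → Finset (Fin n)) :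
    (⨆ i, StanleySpace K (a i) (Z i)) =
      Submodule.span K ((fun b => monomial b (1 : K)) '' ⋃ i, stanleyCell (a i) (Z i)) := by
  simp_rw [stanleySpace_eq_span, Set.image_iUnion, Submodule.span_iUnion]

theorem isStanleyDecomp_of_partition {r : ℕ} {I : Ideal (MvPolynomial (Fin n) K)}
    {a : Fin r → (Fin n →₀ ℕ)} {Z : Fin r → Finset (Fin n)}
    (hd : Pairwise fun i j => Disjoint (stanleyCell (a i) (Z i)) (stanleyCell (a j) (Z j)))
    (hU : (⋃ i, stanleyCell (a i) (Z i)) = {b | monomial b (1 : K) ∉ I}) :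
    IsStanleyDecomp K ⊤ I a Z := by
  refine ⟨fun i => ?_, by rw [iSup_stanleySpace, hU, monomialSpan_top_eq_span]⟩
  simp_rw [stanleySpace_eq_span, ← Submodule.span_iUnion, ← Set.image_iUnion]
  refine linearIndependent_monomial_one.disjoint_span_image ?_
  simp only [Set.disjoint_iUnion_right]
  exact fun j hj => hd hj.symm

theorem IsStanleyDecomp.iUnion_stanleyCell {r : ℕ} {I : Ideal (MvPolynomial (Fin n) K)}
    {a : Fin r → (Fin n →₀ ℕ)} {Z : Fin r → Finset (Fin n)} (h : IsStanleyDecomp K ⊤ I a Z) :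
    (⋃ i, stanleyCell (a i) (Z i)) = {b | monomial b (1 : K) ∉ I} := by
  have h2 := h.2
  rw [iSup_stanleySpace, monomialSpan_top_eq_span] at h2
  have key : ∀ A B : Set (Fin n →₀ ℕ),
      Submodule.span K ((fun b => monomial b (1 : K)) '' A) =
        Submodule.span K ((fun b => monomial b (1 : K)) '' B) → A ⊆ B := by
    intro A B hAB b hb
    by_contra hbB
    refine linearIndependent_monomial_one.notMem_span_image (R := K) hbB ?_
    rw [← hAB]
    exact Submodule.subset_span ⟨b, hb, rfl⟩
  exact (key _ _ h2).antisymm (key _ _ h2.symm)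

theorem monomial_mem_span_monomial_image_iff {G : Set (Fin n →₀ ℕ)} {b : Fin n →₀ ℕ} :
    monomial b (1 : K) ∈ Ideal.span ((fun a => monomial a (1 : K)) '' G) ↔ ∃ u ∈ G, u ≤ b := by
  rw [mem_ideal_span_monomial_image]
  simp

/-- For an associated prime `P` of a monomial ideal `I`, there is a monomial outside `I` which
every variable in `P` multiplies into `I`. -/
theorem exists_monomial_notMem_of_mem_associatedPrimes {I P : Ideal (MvPolynomial (Fin n) K)}
    (hI : IsMonomialIdeal I)
    (hP : P ∈ associatedPrimes (MvPolynomial (Fin n) K) (MvPolynomial (Fin n) K ⧸ I)) :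
    ∃ u : Fin n →₀ ℕ, monomial u (1 : K) ∉ I ∧
      ∀ i, (X i : MvPolynomial (Fin n) K) ∈ P → monomial (u + Finsupp.single i 1) (1 : K) ∈ I := by
  obtain ⟨hprime, x, hx⟩ := isAssociatedPrime_iff.1 (AssociatedPrimes.mem_iff.1 hP)
  obtain ⟨f, rfl⟩ := Ideal.Quotient.mk_surjective x
  have hmem : ∀ g, g ∈ P ↔ g * f ∈ I := by
    intro g
    rw [hx, Submodule.mem_colon_singleton, Submodule.mem_bot, ← Ideal.Quotient.eq_zero_iff_mem,
      map_mul]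
    rfl
  have hf : f ∉ I := by
    intro hf
    exact hprime.ne_top ((Ideal.eq_top_iff_one _).2 ((hmem 1).2 (by simpa using hf)))
  obtain ⟨G, rfl⟩ := hI
  simp only [monomial_mem_span_monomial_image_iff]
  simp only [mem_ideal_span_monomial_image] at hf hmem
  push Not at hf
  obtain ⟨u, hu, huG⟩ := hf
  refine ⟨u, by simpa using huG, fun i hi => (hmem _).1 hi _ ?_⟩
  rw [mem_support_iff, add_comm, coeff_X_mul]
  exact mem_support_iff.1 hu

end Algebra

/-- Let `I ⊂ S = K[x_1,…,x_n]` be a monomial ideal minimally generated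
by `m` monomials such that there is an associated prime `P ∈ Ass(S/I)` of height `m`
(an associated prime of a monomial ideal is generated by a subset of the variables, and
its height is the number of those variables).  Then `sdepth_S(S/I) = n - m`. -/
theorem sdepth_quot_eq_of_associated_prime_height {K : Type*} [Field K] {n m : ℕ}
    (I : Ideal (MvPolynomial (Fin n) K))
    (hmI : IsMonomialIdeal I) (hI0 : I ≠ ⊥) (hI1 : I ≠ ⊤)
    (G : Finset (Fin n →₀ ℕ)) (hGcard : G.card = m)
    (hG : I = Ideal.span ((fun a => MvPolynomial.monomial a (1 : K)) '' ↑G))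
    (hmin : ∀ G' : Finset (Fin n →₀ ℕ),
      I = Ideal.span ((fun a => MvPolynomial.monomial a (1 : K)) '' ↑G') → m ≤ G'.card)
    (P : Ideal (MvPolynomial (Fin n) K))
    (hP : P ∈ associatedPrimes (MvPolynomial (Fin n) K) (MvPolynomial (Fin n) K ⧸ I))
    (V : Finset (Fin n))
    (hPV : P = Ideal.span ((fun i => (MvPolynomial.X i : MvPolynomial (Fin n) K)) '' ↑V))
    (hht : V.card = m) :
    sdepth K ⊤ I = ((n - m : ℕ) : ℕ∞) := by
  have hle : m ≤ n := by simpa [hht] using Finset.card_le_univ V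
  refine le_antisymm (sSup_le ?_) (le_sSup ?_)
  · rintro d ⟨r, a, Z, hdec, hd⟩
    obtain ⟨u, huI, huP⟩ := exists_monomial_notMem_of_mem_associatedPrimes hmI hP
    have hU := hdec.iUnion_stanleyCell
    have hu : u ∈ ⋃ i, stanleyCell (a i) (Z i) := by rwa [hU]
    obtain ⟨i, c, hc, hcu⟩ := Set.mem_iUnion.1 hu
    have hZV : Z i ⊆ Vᶜ := by
      intro k hk
      rw [Finset.mem_compl]
      intro hkV
      have hmem : u + Finsupp.single k 1 ∈ ⋃ i, stanleyCell (a i) (Z i) := by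
        refine Set.mem_iUnion.2 ⟨i, c + Finsupp.single k 1, fun j hj => ?_, ?_⟩
        · rcases Finset.mem_union.1 (Finsupp.support_add hj) with h | h
          · exact hc h
          · rwa [Finset.mem_singleton.1 (Finsupp.support_single_subset h)]
        · rw [hcu, add_assoc]
      rw [hU] at hmem
      exact hmem (huP k (hPV ▸ Ideal.subset_span ⟨k, hkV, rfl⟩))
    refine (hd i).trans (Nat.cast_le.2 ((Finset.card_le_card hZV).trans ?_))
    rw [Finset.card_compl, Fintype.card_fin, hht]
  · obtain ⟨r, a, Z, hd, hU, hc⟩ :=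
      (stanleyPartitionable_compl_upperClosure (d := n - m) G (by omega)).exists_family
    refine ⟨r, a, Z, isStanleyDecomp_of_partition hd ?_, fun i => Nat.cast_le.2 (hc i)⟩
    rw [hU, hG]
    ext b
    simp [monomial_mem_span_monomial_image_iff]
end

section
/- Let I ⊆ J ⊆ S = K[x_1,…,x_n] be monomial ideals and denote S̄ = S[y]. Then sdepth_S(J/I) + 1 ≥ sdepth_{S̄}((JS̄ + (y))/IS̄) ≥ min{ sdepth_S(J/I), sdepth_S(S/I) + 1 }. -/
open MvPolynomial

/-- The exponent vectors of the monomials in the Stanley space `x^a·K[Z]`. -/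
def stanleyCone {n : ℕ} (a : Fin n →₀ ℕ) (Z : Finset (Fin n)) : Set (Fin n →₀ ℕ) :=
  {u | a ≤ u ∧ ∀ i ∉ Z, u i = a i}

theorem stanleySpace_eq_span_image (K : Type*) [Field K] {n : ℕ} (a : Fin n →₀ ℕ)
    (Z : Finset (Fin n)) :
    StanleySpace K a Z = Submodule.span K (basisMonomials (Fin n) K '' stanleyCone a Z) := by
  unfold StanleySpace
  congr 1
  ext p
  simp only [coe_basisMonomials, Set.mem_image, Set.mem_ofPred_eq, stanleyCone]
  constructor
  · rintro ⟨c, hc, rfl⟩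
    refine ⟨a + c, ⟨le_self_add, fun i hi => ?_⟩, rfl⟩
    have : c i = 0 := Finsupp.notMem_support_iff.mp fun h => hi (hc h)
    simp [this]
  · rintro ⟨u, ⟨hau, hu⟩, rfl⟩
    refine ⟨u - a, fun i hi => ?_, by rw [add_tsub_cancel_of_le hau]⟩
    by_contra hiZ
    simp [hu i hiZ] at hi

theorem monomialSpan_eq_span_image (K : Type*) [Field K] {n : ℕ}
    (I J : Ideal (MvPolynomial (Fin n) K)) :
    monomialSpan K I J = Submodule.span K (basisMonomials (Fin n) K ''
      {u | monomial u (1 : K) ∈ I ∧ monomial u (1 : K) ∉ J}) := by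
  unfold monomialSpan
  congr 1
  ext p
  simp only [coe_basisMonomials, Set.mem_image, Set.mem_ofPred_eq]
  constructor
  · rintro ⟨u, rfl, hu⟩
    exact ⟨u, hu, rfl⟩
  · rintro ⟨u, hu, rfl⟩
    exact ⟨u, rfl, hu⟩

theorem Module.Basis.mem_span_image_iff_mem {ι R M : Type*} [Semiring R] [Nontrivial R]
    [AddCommMonoid M] [Module R M] (b : Module.Basis ι R M) {s : Set ι} {i : ι} :
    b i ∈ Submodule.span R (b '' s) ↔ i ∈ s := by
  rw [b.mem_span_image, b.repr_self, Finsupp.support_single _ one_ne_zero]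
  simp

theorem Module.Basis.span_image_inj {ι R M : Type*} [Semiring R] [Nontrivial R]
    [AddCommMonoid M] [Module R M] (b : Module.Basis ι R M) {s t : Set ι} :
    Submodule.span R (b '' s) = Submodule.span R (b '' t) ↔ s = t := by
  refine ⟨fun h => ?_, fun h => h ▸ rfl⟩
  ext i
  rw [← b.mem_span_image_iff_mem, h, b.mem_span_image_iff_mem]

theorem Module.Basis.iSupIndep_span_image {ι κ R M : Type*} [Ring R] [Nontrivial R]
    [AddCommGroup M] [Module R M] (b : Module.Basis ι R M) (s : κ → Set ι) :
    iSupIndep (fun k => Submodule.span R (b '' s k)) ↔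
      Pairwise (Function.onFun Disjoint s) := by
  constructor
  · intro h k l hkl
    refine Set.disjoint_left.mpr fun i hik hil => b.ne_zero i ?_
    exact Submodule.disjoint_def.mp (h.pairwiseDisjoint hkl) _
      (b.mem_span_image_iff_mem.mpr hik) (b.mem_span_image_iff_mem.mpr hil)
  · intro h k
    simp only [← Submodule.span_iUnion, ← Set.image_iUnion]
    refine b.linearIndependent.disjoint_span_image ?_
    simp only [Set.disjoint_iUnion_right]
    exact fun l hl => h hl.symm

theorem isStanleyDecomp_iff (K : Type*) [Field K] {n r : ℕ}
    (I J : Ideal (MvPolynomial (Fin n) K))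
    (a : Fin r → (Fin n →₀ ℕ)) (Z : Fin r → Finset (Fin n)) :
    IsStanleyDecomp K I J a Z ↔
      Pairwise (Function.onFun Disjoint fun i => stanleyCone (a i) (Z i)) ∧
      ∀ u, (∃ i, u ∈ stanleyCone (a i) (Z i)) ↔
        monomial u (1 : K) ∈ I ∧ monomial u (1 : K) ∉ J := by
  unfold IsStanleyDecomp
  simp only [stanleySpace_eq_span_image, monomialSpan_eq_span_image,
    Module.Basis.iSupIndep_span_image, ← Submodule.span_iUnion, ← Set.image_iUnion,
    Module.Basis.span_image_inj, Set.ext_iff, Set.mem_iUnion, Set.mem_ofPred_eq]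

/-- A partition of the monomials of `I \ J` into Stanley cones, indexed by any finite type,
yields a Stanley decomposition. -/
theorem exists_isStanleyDecomp (K : Type*) [Field K] {n : ℕ} {ι : Type*} [Finite ι]
    {I J : Ideal (MvPolynomial (Fin n) K)}
    (a : ι → (Fin n →₀ ℕ)) (Z : ι → Finset (Fin n))
    (hdisj : ∀ i j u, u ∈ stanleyCone (a i) (Z i) → u ∈ stanleyCone (a j) (Z j) → i = j)
    (hunion : ∀ u, (∃ i, u ∈ stanleyCone (a i) (Z i)) ↔
        monomial u (1 : K) ∈ I ∧ monomial u (1 : K) ∉ J)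
    {d : ℕ∞} (hd : ∀ i, d ≤ ((Z i).card : ℕ∞)) :
    ∃ (r : ℕ) (a : Fin r → (Fin n →₀ ℕ)) (Z : Fin r → Finset (Fin n)),
      IsStanleyDecomp K I J a Z ∧ ∀ i, d ≤ ((Z i).card : ℕ∞) := by
  obtain ⟨r, ⟨e⟩⟩ := Finite.exists_equiv_fin ι
  refine ⟨r, a ∘ e.symm, Z ∘ e.symm, (isStanleyDecomp_iff ..).mpr ⟨fun i j hij => ?_, ?_⟩,
    fun i => hd _⟩
  · exact Set.disjoint_left.mpr fun u hi hj => hij (e.symm.injective (hdisj _ _ u hi hj))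
  · intro u
    rw [← hunion u]
    exact e.symm.exists_congr_left.trans (by simp)

theorem monomial_mem_span_monomial_image {K σ : Type*} [Field K] {G : Set (σ →₀ ℕ)}
    {u : σ →₀ ℕ} :
    monomial u (1 : K) ∈ Ideal.span ((fun a => monomial a (1 : K)) '' G) ↔
      ∃ g ∈ G, g ≤ u := by
  classical
  rw [mem_ideal_span_monomial_image, support_monomial, if_neg one_ne_zero]
  simp

/-- A monomial ideal has generators of bounded degree in each variable. -/
theorem IsMonomialIdeal.exists_bounded_generators {K : Type*} [Field K] {n : ℕ}
    {I : Ideal (MvPolynomial (Fin n) K)} (hI : IsMonomialIdeal I) :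
    ∃ (G : Set (Fin n →₀ ℕ)) (g : Fin n →₀ ℕ), (∀ a ∈ G, a ≤ g) ∧
      I = Ideal.span ((fun a => monomial a (1 : K)) '' G) := by
  obtain ⟨G, rfl⟩ := hI
  obtain ⟨F, hF, hspan⟩ := (Submodule.fg_span_iff_fg_span_finset_subset _).mp
    (IsNoetherian.noetherian (Ideal.span ((fun a => monomial a (1 : K)) '' G)))
  obtain ⟨G₀, -, hG₀⟩ := Set.subset_image_iff.mp hF
  have hfin : G₀.Finite := Set.Finite.of_finite_image (hG₀ ▸ F.finite_toSet)
    (monomial_left_injective one_ne_zero).injOn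
  obtain ⟨g, hg⟩ := hfin.bddAbove
  exact ⟨G₀, g, fun a ha => hg ha, by rw [hG₀]; exact hspan⟩

/-- The quotient of the polynomial ring by a monomial ideal has a Stanley decomposition. -/
theorem IsMonomialIdeal.exists_isStanleyDecomp_top {K : Type*} [Field K] {n : ℕ}
    {I : Ideal (MvPolynomial (Fin n) K)} (hI : IsMonomialIdeal I) :
    ∃ (r : ℕ) (a : Fin r → (Fin n →₀ ℕ)) (Z : Fin r → Finset (Fin n)),
      IsStanleyDecomp K ⊤ I a Z ∧ ∀ i, (0 : ℕ∞) ≤ ((Z i).card : ℕ∞) := by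
  obtain ⟨G, g, hg, rfl⟩ := hI.exists_bounded_generators
  have hcone : ∀ c ≤ g, ∀ u,
      u ∈ stanleyCone c (Finset.univ.filter fun i => c i = g i) ↔ u ⊓ g = c := by
    intro c hc u
    simp only [stanleyCone, Set.mem_ofPred_eq, Finsupp.ext_iff, Finsupp.le_def,
      Finsupp.inf_apply, ← forall_and, Finset.mem_filter, Finset.mem_univ, true_and]
    refine forall_congr' fun i => ?_
    have := hc i
    grind
  have hfin : Finite {c : Fin n →₀ ℕ // c ≤ g ∧
      monomial c (1 : K) ∉ Ideal.span ((fun a => monomial a (1 : K)) '' G)} :=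
    ((Set.finite_Iic g).subset fun c hc => hc.1).to_subtype
  refine exists_isStanleyDecomp K (ι := {c : Fin n →₀ ℕ // c ≤ g ∧
      monomial c (1 : K) ∉ Ideal.span ((fun a => monomial a (1 : K)) '' G)})
    (fun c => c.1) (fun c => Finset.univ.filter fun i => c.1 i = g i) ?_ ?_ (fun _ => zero_le)
  · rintro ⟨c, hc⟩ ⟨d, hd⟩ u h₁ h₂
    exact Subtype.ext (((hcone c hc.1 u).mp h₁).symm.trans ((hcone d hd.1 u).mp h₂))
  · intro u
    have key : monomial u (1 : K) ∈ Ideal.span ((fun a => monomial a (1 : K)) '' G) ↔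
        monomial (u ⊓ g) (1 : K) ∈ Ideal.span ((fun a => monomial a (1 : K)) '' G) := by
      simp only [monomial_mem_span_monomial_image, le_inf_iff]
      exact exists_congr fun a => and_congr_right fun ha => (and_iff_left (hg a ha)).symm
    rw [key]
    constructor
    · rintro ⟨⟨c, hc⟩, hu⟩
      rw [(hcone c hc.1 u).mp hu]
      exact ⟨Submodule.mem_top, hc.2⟩
    · rintro ⟨-, hu⟩
      exact ⟨⟨u ⊓ g, inf_le_right, hu⟩, (hcone _ inf_le_right u).mpr rfl⟩

/-- The exponent vector of `x^u·y^k` in `K[x₁,…,xₙ,y]`. -/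
noncomputable def snocExponent {n : ℕ} (u : Fin n →₀ ℕ) (k : ℕ) : Fin (n + 1) →₀ ℕ :=
  Finsupp.equivFunOnFinite.symm (Fin.snoc (α := fun _ => ℕ) u k)

/-- The exponent vector of the image of a monomial of `K[x₁,…,xₙ,y]` under `y ↦ 1`. -/
noncomputable def initExponent {n : ℕ} (v : Fin (n + 1) →₀ ℕ) : Fin n →₀ ℕ :=
  Finsupp.equivFunOnFinite.symm fun i => v i.castSucc

@[simp]
theorem snocExponent_castSucc {n : ℕ} (u : Fin n →₀ ℕ) (k : ℕ) (i : Fin n) :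
    snocExponent u k i.castSucc = u i := by
  simp [snocExponent]

@[simp]
theorem snocExponent_last {n : ℕ} (u : Fin n →₀ ℕ) (k : ℕ) :
    snocExponent u k (Fin.last n) = k := by
  simp [snocExponent]

@[simp]
theorem initExponent_apply {n : ℕ} (v : Fin (n + 1) →₀ ℕ) (i : Fin n) :
    initExponent v i = v i.castSucc := rfl

@[simp]
theorem initExponent_snocExponent {n : ℕ} (u : Fin n →₀ ℕ) (k : ℕ) :
    initExponent (snocExponent u k) = u := by
  ext i
  simp

theorem mapDomain_castSucc_le_iff {n : ℕ} (g : Fin n →₀ ℕ) (v : Fin (n + 1) →₀ ℕ) :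
    g.mapDomain Fin.castSucc ≤ v ↔ g ≤ initExponent v := by
  simp only [Finsupp.le_def, Fin.forall_fin_succ', initExponent_apply,
    Finsupp.mapDomain_apply (Fin.castSucc_injective n)]
  rw [Finsupp.mapDomain_of_notMem_range]
  · simp
  · rintro ⟨i, hi⟩
    exact Fin.castSucc_ne_last i hi

theorem extIdeal_span_monomial {K : Type*} [Field K] {m n : ℕ} (f : Fin m → Fin n)
    (G : Set (Fin m →₀ ℕ)) :
    extIdeal f (Ideal.span ((fun a => monomial a (1 : K)) '' G)) =
      Ideal.span ((fun a => monomial a (1 : K)) '' (Finsupp.mapDomain f '' G)) := by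
  rw [extIdeal, Ideal.map_span, Set.image_image, Set.image_image]
  simp only [rename_monomial]

theorem IsMonomialIdeal.monomial_mem_extIdeal_iff {K : Type*} [Field K] {n : ℕ}
    {I : Ideal (MvPolynomial (Fin n) K)} (hI : IsMonomialIdeal I) (v : Fin (n + 1) →₀ ℕ) :
    monomial v (1 : K) ∈ extIdeal Fin.castSucc I ↔ monomial (initExponent v) (1 : K) ∈ I := by
  obtain ⟨G, rfl⟩ := hI
  simp only [extIdeal_span_monomial, monomial_mem_span_monomial_image, Set.exists_mem_image,
    mapDomain_castSucc_le_iff]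

theorem IsMonomialIdeal.monomial_mem_extIdeal_sup_iff {K : Type*} [Field K] {n : ℕ}
    {J : Ideal (MvPolynomial (Fin n) K)} (hJ : IsMonomialIdeal J) (v : Fin (n + 1) →₀ ℕ) :
    monomial v (1 : K) ∈ extIdeal Fin.castSucc J ⊔ Ideal.span {X (Fin.last n)} ↔
      monomial (initExponent v) (1 : K) ∈ J ∨ 1 ≤ v (Fin.last n) := by
  obtain ⟨G, rfl⟩ := hJ
  have hX : ({X (Fin.last n)} : Set (MvPolynomial (Fin (n + 1)) K)) =
      (fun a => monomial a (1 : K)) '' {Finsupp.single (Fin.last n) 1} := by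
    rw [Set.image_singleton]
    rfl
  rw [extIdeal_span_monomial, hX, ← Ideal.span_union, ← Set.image_union]
  simp only [monomial_mem_span_monomial_image, Set.mem_union, or_and_right, exists_or,
    Set.mem_singleton_iff, exists_eq_left, Set.exists_mem_image, mapDomain_castSucc_le_iff,
    Finsupp.single_le_iff]

theorem mem_stanleyCone_snocExponent_zero {n : ℕ} (a : Fin n →₀ ℕ) (Z : Finset (Fin n))
    (v : Fin (n + 1) →₀ ℕ) :
    v ∈ stanleyCone (snocExponent a 0) (Z.map Fin.castSuccEmb) ↔
      v (Fin.last n) = 0 ∧ initExponent v ∈ stanleyCone a Z := by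
  simp only [stanleyCone, Set.mem_ofPred_eq, Finsupp.le_def, Fin.forall_fin_succ',
    snocExponent_castSucc, snocExponent_last, initExponent_apply, Finset.mem_map,
    Fin.coe_castSuccEmb, Fin.castSucc_inj, exists_eq_right, Fin.castSucc_ne_last]
  simp
  tauto

theorem mem_stanleyCone_snocExponent_one {n : ℕ} (a : Fin n →₀ ℕ) (Z : Finset (Fin n))
    (v : Fin (n + 1) →₀ ℕ) :
    v ∈ stanleyCone (snocExponent a 1)
        (Finset.cons (Fin.last n) (Z.map Fin.castSuccEmb) (by simp)) ↔
      1 ≤ v (Fin.last n) ∧ initExponent v ∈ stanleyCone a Z := by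
  simp only [stanleyCone, Set.mem_ofPred_eq, Finsupp.le_def, Fin.forall_fin_succ',
    snocExponent_castSucc, snocExponent_last, initExponent_apply, Finset.mem_cons,
    Finset.mem_map, Fin.coe_castSuccEmb, Fin.castSucc_inj, exists_eq_right, Fin.castSucc_ne_last]
  simp
  tauto

theorem snocExponent_zero_mem_stanleyCone {n : ℕ} (a : Fin (n + 1) →₀ ℕ)
    (Z : Finset (Fin (n + 1))) (u : Fin n →₀ ℕ) :
    snocExponent u 0 ∈ stanleyCone a Z ↔ a (Fin.last n) = 0 ∧
      u ∈ stanleyCone (initExponent a) (Finset.univ.filter fun i => i.castSucc ∈ Z) := by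
  simp only [stanleyCone, Set.mem_ofPred_eq, Finsupp.le_def, Fin.forall_fin_succ',
    snocExponent_castSucc, snocExponent_last, initExponent_apply, Finset.mem_filter,
    Finset.mem_univ, true_and, Nat.le_zero]
  grind

theorem card_le_card_filter_castSucc_mem {n : ℕ} (Z : Finset (Fin (n + 1))) :
    Z.card ≤ (Finset.univ.filter fun i : Fin n => i.castSucc ∈ Z).card + 1 := by
  rw [← Finset.card_map (s := Finset.univ.filter _) Fin.castSuccEmb,
    ← Finset.card_cons (a := Fin.last n) (h := by simp)]
  refine Finset.card_le_card fun i => ?_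
  induction i using Fin.lastCases <;> simp

theorem sdepth_adjoin_variable_le {K : Type*} [Field K] {n : ℕ}
    {I J : Ideal (MvPolynomial (Fin n) K)} (hI : IsMonomialIdeal I) (hJ : IsMonomialIdeal J) :
    sdepth K (extIdeal Fin.castSucc J ⊔ Ideal.span {X (Fin.last n)}) (extIdeal Fin.castSucc I) ≤
      sdepth K J I + 1 := by
  refine sSup_le ?_
  rintro d ⟨r, a, Z, hdec, hd⟩
  obtain ⟨hdisj, hunion⟩ := (isStanleyDecomp_iff ..).mp hdec
  rw [← tsub_le_iff_right]
  refine le_sSup (exists_isStanleyDecomp K (ι := {i // a i (Fin.last n) = 0})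
    (fun i => initExponent (a i)) (fun i => Finset.univ.filter fun j => j.castSucc ∈ Z i)
    ?_ ?_ ?_)
  · rintro ⟨i, hi⟩ ⟨j, hj⟩ u hui huj
    refine Subtype.ext (hdisj.eq (Set.not_disjoint_iff.mpr ⟨snocExponent u 0, ?_, ?_⟩))
    · exact (snocExponent_zero_mem_stanleyCone ..).mpr ⟨hi, hui⟩
    · exact (snocExponent_zero_mem_stanleyCone ..).mpr ⟨hj, huj⟩
  · intro u
    have h := hunion (snocExponent u 0)
    simpa [hI.monomial_mem_extIdeal_iff, hJ.monomial_mem_extIdeal_sup_iff,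
      snocExponent_zero_mem_stanleyCone] using h
  · rintro ⟨i, -⟩
    rw [tsub_le_iff_right]
    exact (hd i).trans (mod_cast card_le_card_filter_castSucc_mem (Z i))

theorem min_le_sdepth_adjoin_variable {K : Type*} [Field K] {n : ℕ}
    {I J : Ideal (MvPolynomial (Fin n) K)} (hI : IsMonomialIdeal I) (hJ : IsMonomialIdeal J)
    {r s : ℕ} {a : Fin r → (Fin n →₀ ℕ)} {Z : Fin r → Finset (Fin n)}
    {b : Fin s → (Fin n →₀ ℕ)} {W : Fin s → Finset (Fin n)}
    (ha : IsStanleyDecomp K J I a Z) (hb : IsStanleyDecomp K ⊤ I b W) {α β : ℕ∞}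
    (hα : ∀ i, α ≤ ((Z i).card : ℕ∞)) (hβ : ∀ i, β ≤ ((W i).card : ℕ∞)) :
    min α (β + 1) ≤ sdepth K (extIdeal Fin.castSucc J ⊔ Ideal.span {X (Fin.last n)})
      (extIdeal Fin.castSucc I) := by
  obtain ⟨hadisj, haunion⟩ := (isStanleyDecomp_iff ..).mp ha
  obtain ⟨hbdisj, hbunion⟩ := (isStanleyDecomp_iff ..).mp hb
  refine le_sSup (exists_isStanleyDecomp K (ι := Fin r ⊕ Fin s)
    (Sum.elim (fun i => snocExponent (a i) 0) (fun i => snocExponent (b i) 1))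
    (Sum.elim (fun i => (Z i).map Fin.castSuccEmb)
      (fun i => Finset.cons (Fin.last n) ((W i).map Fin.castSuccEmb) (by simp)))
    ?_ ?_ ?_)
  · rintro (i | i) (j | j) u hi hj <;>
      simp only [Sum.elim_inl, Sum.elim_inr, mem_stanleyCone_snocExponent_zero,
        mem_stanleyCone_snocExponent_one] at hi hj
    · exact congrArg _ (hadisj.eq (Set.not_disjoint_iff.mpr ⟨_, hi.2, hj.2⟩))
    · omega
    · omega
    · exact congrArg _ (hbdisj.eq (Set.not_disjoint_iff.mpr ⟨_, hi.2, hj.2⟩))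
  · intro v
    simp only [Sum.exists, Sum.elim_inl, Sum.elim_inr, mem_stanleyCone_snocExponent_zero,
      mem_stanleyCone_snocExponent_one, exists_and_left, haunion, hbunion,
      hI.monomial_mem_extIdeal_iff, hJ.monomial_mem_extIdeal_sup_iff, Submodule.mem_top, true_and]
    rcases Nat.eq_zero_or_pos (v (Fin.last n)) with h | h
    · simp [h]
    · simp [h.ne', Nat.one_le_iff_ne_zero]
  · rintro (i | i)
    · simpa using Or.inl (hα i)
    · refine (min_le_right _ _).trans ?_
      simpa using add_le_add_left (hβ i) 1

theorem min_sdepth_le_sdepth_adjoin_variable {K : Type*} [Field K] {n : ℕ}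
    {I J : Ideal (MvPolynomial (Fin n) K)} (hI : IsMonomialIdeal I) (hJ : IsMonomialIdeal J) :
    min (sdepth K J I) (sdepth K ⊤ I + 1) ≤
      sdepth K (extIdeal Fin.castSucc J ⊔ Ideal.span {X (Fin.last n)})
        (extIdeal Fin.castSucc I) := by
  refine le_of_forall_lt fun c hc => ?_
  obtain ⟨h₁, h₂⟩ := lt_min_iff.mp hc
  obtain ⟨α, ⟨r, a, Z, ha, hα⟩, hcα⟩ := lt_sSup_iff.mp h₁
  rw [sdepth, ENat.sSup_add ⟨0, hI.exists_isStanleyDecomp_top⟩] at h₂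
  obtain ⟨β, ⟨s, b, W, hb, hβ⟩, hcβ⟩ := lt_biSup_iff.mp h₂
  exact (lt_min hcα hcβ).trans_le (min_le_sdepth_adjoin_variable hI hJ ha hb hα hβ)

/-- Let `I ⊆ J ⊆ S = K[x_1,…,x_n]` be monomial ideals and `S̄ = S[y]`.
Then `sdepth_S(J/I) + 1 ≥ sdepth_{S̄}((JS̄ + (y))/IS̄) ≥ min(sdepth_S(J/I), sdepth_S(S/I) + 1)`. -/
theorem sdepth_adjoin_variable_quot_bounds {K : Type*} [Field K] {n : ℕ}
    (I J : Ideal (MvPolynomial (Fin n) K))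
    (hmI : IsMonomialIdeal I) (hmJ : IsMonomialIdeal J) (hIJ : I ≤ J) :
    sdepth K J I + 1 ≥
      sdepth K (extIdeal Fin.castSucc J ⊔ Ideal.span {MvPolynomial.X (Fin.last n)})
        (extIdeal Fin.castSucc I) ∧
    sdepth K (extIdeal Fin.castSucc J ⊔ Ideal.span {MvPolynomial.X (Fin.last n)})
        (extIdeal Fin.castSucc I) ≥
      min (sdepth K J I) (sdepth K ⊤ I + 1) := by
  exact ⟨sdepth_adjoin_variable_le hmI hmJ, min_sdepth_le_sdepth_adjoin_variable hmI hmJ⟩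
end

section
/- The following two assertions are equivalent: (1) for every n ≥ 1 and every monomial ideal I ⊂ S = K[x_1,…,x_n], one has sdepth_S(I) ≥ depth_S(I); (2) for every n ≥ 1 and every monomial ideal I ⊂ S = K[x_1,…,x_n], setting S̄ = S[y], the equality sdepth_{S̄}((I, y)) = depth_S(I) implies sdepth_S(I) = depth_S(I). -/
open MvPolynomial

section Depth

open CategoryTheory Abelian

universe u

/-- There is an `M`-regular sequence of length `k` contained in `m`. -/
def HasRegularSeq {R : Type u} [CommRing R] (m : Ideal R) (M : Type u) [AddCommGroup M]
    [Module R M] (k : ℕ) : Prop :=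
  ∃ rs : List R, rs.length = k ∧ (∀ r ∈ rs, r ∈ m) ∧ RingTheory.Sequence.IsRegular M rs

variable {R : Type u} [CommRing R]

lemma hasRegularSeq_iff_ext [IsNoetherianRing R] (m : Ideal R) (M : Type u) [AddCommGroup M]
    [Module R M] [Module.Finite R M] (hM : m • (⊤ : Submodule R M) < ⊤) (k : ℕ) :
    HasRegularSeq m M k ↔
      ∀ i < k, Subsingleton (Ext (ModuleCat.of R (Shrink.{u} (R ⧸ m))) (ModuleCat.of R M) i) :=
  ((ModuleCat.exists_isRegular_tfae m k (ModuleCat.of R M) hM).out 3 1)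

lemma Ideal.smul_top_lt_top_of_isDomain [IsDomain R] {m I : Ideal R} (hm : m ≠ ⊤) (hI : I ≠ ⊥)
    (hfg : I.FG) : m • (⊤ : Submodule R I) < ⊤ := by
  rw [lt_top_iff_ne_top]
  intro h
  obtain ⟨r, hr, hz⟩ := Submodule.exists_sub_one_mem_and_smul_eq_zero_of_fg_of_le_smul m
    (⊤ : Submodule R I) ((Submodule.fg_top I).2 hfg) h.ge
  obtain ⟨x, hxI, hx⟩ := Submodule.exists_mem_ne_zero_of_ne_bot hI
  have h0 : r * x = 0 := congrArg Subtype.val (hz ⟨x, hxI⟩ trivial)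
  have hr0 : r = 0 := (mul_eq_zero.1 h0).resolve_right hx
  apply hm
  rw [Ideal.eq_top_iff_one]
  simpa [hr0] using m.neg_mem hr

lemma Ideal.smul_top_quotient_lt_top {m I : Ideal R} (hm : m ≠ ⊤) (hI : I ≤ m) :
    m • (⊤ : Submodule R (R ⧸ I)) < ⊤ := by
  rw [lt_top_iff_ne_top]
  intro h
  apply hm
  have h1 := congrArg (Submodule.comap I.mkQ) h
  rw [Submodule.comap_smul_top_of_surjective _ _ (Submodule.mkQ_surjective I)] at h1
  simpa [hI] using h1

/-- The depth of a nonzero ideal exceeds that of its quotient ring by one. -/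
lemma hasRegularSeq_ideal_succ_iff [IsNoetherianRing R] [IsDomain R] {m I : Ideal R} (hm : m ≠ ⊤)
    (hI : I ≠ ⊥) (hIm : I ≤ m) {k n : ℕ} (hR : HasRegularSeq m R n) (hk : k < n) :
    HasRegularSeq m I (k + 1) ↔ HasRegularSeq m (R ⧸ I) k := by
  rw [hasRegularSeq_iff_ext m I (Ideal.smul_top_lt_top_of_isDomain hm hI I.fg_of_isNoetherianRing),
    hasRegularSeq_iff_ext m (R ⧸ I) (Ideal.smul_top_quotient_lt_top hm hIm)]
  rw [hasRegularSeq_iff_ext m R (by simpa [lt_top_iff_ne_top] using hm)] at hR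
  have hex : Function.Exact I.subtype I.mkQ := by
    rw [LinearMap.exact_iff]; simp
  have hS : (ModuleCat.shortComplexOfCompEqZero I.subtype I.mkQ
      hex.linearMap_comp_eq_zero).ShortExact :=
    ModuleCat.shortComplex_shortExact _ hex I.injective_subtype I.mkQ_surjective
  set N := ModuleCat.of R (Shrink.{u} (R ⧸ m))
  have hmono := hS.mono_f
  constructor
  · intro h i hi
    refine ⟨fun a b => ?_⟩
    have key : ∀ x : Ext N (ModuleCat.of R (R ⧸ I)) i, x = 0 := fun x => by
      have := h (i + 1) (by lia)
      have := hR i (by lia)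
      obtain ⟨x₂, rfl⟩ := Ext.covariant_sequence_exact₃ N hS x rfl (Subsingleton.elim _ _)
      rw [show x₂ = 0 from Subsingleton.elim _ _, Ext.zero_comp]
    rw [key a, key b]
  · intro h i hi
    refine ⟨fun a b => ?_⟩
    have key : ∀ x : Ext N (ModuleCat.of R I) i, x = 0 := fun x => by
      have := hR i (by lia)
      cases i with
      | zero =>
        exact Ext.postcomp_mk₀_injective_of_mono N
          (ModuleCat.shortComplexOfCompEqZero I.subtype I.mkQ hex.linearMap_comp_eq_zero).f
          (Subsingleton.elim (α := Ext N (ModuleCat.of R R) 0) _ _)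
      | succ i =>
        have := h i (by lia)
        obtain ⟨x₃, rfl⟩ := Ext.covariant_sequence_exact₁ N hS x
          (Subsingleton.elim (α := Ext N (ModuleCat.of R R) _) _ _) rfl
        rw [show x₃ = 0 from Subsingleton.elim _ _, Ext.zero_comp]
    rw [key a, key b]

lemma length_le_supportDim_of_isRegular (rs : List R) (M : Type u) [AddCommGroup M] [Module R M]
    [Module.Finite R M] (h : RingTheory.Sequence.IsRegular M rs) :
    (rs.length : WithBot ℕ∞) ≤ Module.supportDim R M := by
  induction rs generalizing M with
  | nil =>
    have := h.nontrivial
    simpa [Order.krullDim_nonneg_iff, Module.supportDim] using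
      (Module.nonempty_support_of_nontrivial (R := R) (M := M)).to_subtype
  | cons r rs ih =>
    rw [RingTheory.Sequence.isRegular_cons_iff] at h
    have h1 := Module.supportDim_quotSMulTop_succ_le_of_notMem_minimalPrimes (x := r) (M := M)
      fun _ hp => h.1.notMem_of_mem_minimalPrimes hp
    refine le_trans ?_ h1
    push_cast [List.length_cons]
    gcongr
    exact ih _ h.2

lemma IsRegular.congr_algebraMap {R' : Type u} [CommRing R'] [Algebra R R']
    (M : Type u) [AddCommGroup M] [Module R M] [Module R' M] [IsScalarTower R R' M] (rs : List R) :
    RingTheory.Sequence.IsRegular M (rs.map (algebraMap R R')) ↔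
      RingTheory.Sequence.IsRegular M rs := by
  have key : ((Ideal.ofList (rs.map (algebraMap R R')) • ⊤ : Submodule R' M) = ⊤ ↔
    (Ideal.ofList rs • ⊤ : Submodule R M) = ⊤) := by
    rw [← Ideal.map_ofList, ← Submodule.restrictScalars_eq_top_iff R R' M,
      Ideal.smul_restrictScalars, Submodule.restrictScalars_top]
  constructor
  · rintro ⟨h1, h2⟩
    exact ⟨(RingTheory.Sequence.isWeaklyRegular_map_algebraMap_iff R' M rs).1 h1,
      fun h => h2 (key.2 h.symm).symm⟩
  · rintro ⟨h1, h2⟩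
    exact ⟨(RingTheory.Sequence.isWeaklyRegular_map_algebraMap_iff R' M rs).2 h1,
      fun h => h2 (key.1 h.symm).symm⟩

lemma hasRegularSeq_quotient_iff_of_surjective {R' : Type u} [CommRing R'] [Algebra R R']
    (hs : Function.Surjective (algebraMap R R')) (m J : Ideal R) (I : Ideal R')
    (hJ : I.comap (algebraMap R R') = J) (k : ℕ) :
    HasRegularSeq m (R ⧸ J) k ↔ HasRegularSeq (m.map (algebraMap R R')) (R' ⧸ I) k := by
  let f : R →ₗ[R] (R' ⧸ I) := (Algebra.linearMap R (R' ⧸ I))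
  have hf : Function.Surjective f := Ideal.Quotient.mk_surjective.comp hs
  have hker : LinearMap.ker f = J := by
    ext x
    rw [← hJ, Ideal.mem_comap]
    exact Ideal.Quotient.eq_zero_iff_mem
  let e : (R ⧸ J) ≃ₗ[R] (R' ⧸ I) :=
    (Submodule.quotEquivOfEq _ _ hker.symm).trans (f.quotKerEquivOfSurjective hf)
  have h1 : HasRegularSeq m (R ⧸ J) k ↔ HasRegularSeq m (R' ⧸ I) k := by
    unfold HasRegularSeq
    simp only [e.isRegular_congr]
  rw [h1]
  constructor
  · rintro ⟨rs, hl, hm, hr⟩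
    refine ⟨rs.map (algebraMap R R'), by simpa using hl, ?_, (IsRegular.congr_algebraMap _ rs).2 hr⟩
    intro r hrm
    obtain ⟨a, ha, rfl⟩ := List.mem_map.1 hrm
    exact Ideal.mem_map_of_mem _ (hm a ha)
  · rintro ⟨rs, hl, hm, hr⟩
    simp only [Ideal.mem_map_iff_of_surjective _ hs] at hm
    choose! g hg hg' using hm
    have hrs : (rs.map g).map (algebraMap R R') = rs := by
      rw [List.map_map]
      exact (List.map_congr_left hg').trans (List.map_id' rs)
    refine ⟨rs.map g, by simpa using hl, ?_, ?_⟩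
    · intro r hrm
      obtain ⟨a, ha, rfl⟩ := List.mem_map.1 hrm
      exact hg a ha
    · rw [← IsRegular.congr_algebraMap (R' := R'), hrs]; exact hr

end Depth

section Adjoin

universe u

variable {K : Type u} [Field K]

lemma X_mem_idealOfVars {n : ℕ} (i : Fin n) : X i ∈ idealOfVars (Fin n) K :=
  Ideal.subset_span (Set.mem_range_self i)

/-- The ideal `(I, y)` of `S[y]`. -/
noncomputable abbrev adjoinVar {n : ℕ} (I : Ideal (MvPolynomial (Fin n) K)) :
    Ideal (MvPolynomial (Fin (n + 1)) K) :=
  extIdeal Fin.castSucc I ⊔ Ideal.span {MvPolynomial.X (Fin.last n)}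

/-- The evaluation `S[y] → S` at `y = 0`. -/
noncomputable def evalLastZero (K : Type u) [Field K] (n : ℕ) :
    MvPolynomial (Fin (n + 1)) K →ₐ[K] MvPolynomial (Fin n) K :=
  aeval (Fin.lastCases 0 X)

@[simp]
lemma evalLastZero_X_last (n : ℕ) : evalLastZero K n (X (Fin.last n)) = 0 := by
  simp [evalLastZero]

@[simp]
lemma evalLastZero_X_castSucc {n : ℕ} (i : Fin n) :
    evalLastZero K n (X i.castSucc) = X i := by
  simp [evalLastZero]

@[simp]
lemma evalLastZero_rename {n : ℕ} (p : MvPolynomial (Fin n) K) :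
    evalLastZero K n (rename Fin.castSucc p) = p := by
  have : (evalLastZero K n).comp (rename Fin.castSucc) = AlgHom.id K _ := by
    ext i; simp
  exact DFunLike.congr_fun this p

lemma sub_rename_evalLastZero_mem {n : ℕ} (p : MvPolynomial (Fin (n + 1)) K) :
    p - rename Fin.castSucc (evalLastZero K n p) ∈
      Ideal.span {(X (Fin.last n) : MvPolynomial (Fin (n + 1)) K)} := by
  rw [← Ideal.Quotient.eq_zero_iff_mem, map_sub, sub_eq_zero]
  have : Ideal.Quotient.mkₐ K (Ideal.span {(X (Fin.last n) : MvPolynomial (Fin (n + 1)) K)}) =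
      ((Ideal.Quotient.mkₐ K _).comp (rename Fin.castSucc)).comp (evalLastZero K n) := by
    ext i
    induction i using Fin.lastCases with
    | last => simp [Ideal.Quotient.mkₐ_eq_mk]
    | cast i => simp
  exact DFunLike.congr_fun this p

lemma mem_adjoinVar_iff {n : ℕ} (I : Ideal (MvPolynomial (Fin n) K))
    (p : MvPolynomial (Fin (n + 1)) K) : p ∈ adjoinVar I ↔ evalLastZero K n p ∈ I := by
  constructor
  · intro h
    have hle : adjoinVar I ≤ I.comap (evalLastZero K n) := by
      refine sup_le (Ideal.map_le_iff_le_comap.2 fun q hq => ?_) ?_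
      · simpa using hq
      · simp [Ideal.span_le]
    exact hle h
  · intro h
    have h1 := sub_rename_evalLastZero_mem p
    have h2 := Ideal.mem_map_of_mem
      (rename Fin.castSucc : MvPolynomial (Fin n) K →ₐ[K] MvPolynomial (Fin (n + 1)) K) h
    rw [← sub_add_cancel p (rename Fin.castSucc (evalLastZero K n p))]
    exact add_mem (Ideal.mem_sup_right h1) (Ideal.mem_sup_left h2)

lemma map_evalLastZero_idealOfVars (n : ℕ) :
    (idealOfVars (Fin (n + 1)) K).map (evalLastZero K n) = idealOfVars (Fin n) K := by
  rw [Ideal.map_span]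
  apply le_antisymm
  · rw [Ideal.span_le]
    rintro _ ⟨_, ⟨i, rfl⟩, rfl⟩
    induction i using Fin.lastCases with
    | last => simp
    | cast i => simpa using X_mem_idealOfVars i
  · rw [Ideal.span_le]
    rintro _ ⟨i, rfl⟩
    exact Ideal.subset_span ⟨X i.castSucc, ⟨_, rfl⟩, by simp⟩

lemma hasRegularSeq_quotient_adjoinVar_iff {n : ℕ} (I : Ideal (MvPolynomial (Fin n) K)) (k : ℕ) :
    HasRegularSeq (idealOfVars (Fin (n + 1)) K) (MvPolynomial (Fin (n + 1)) K ⧸ adjoinVar I) k ↔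
      HasRegularSeq (idealOfVars (Fin n) K) (MvPolynomial (Fin n) K ⧸ I) k := by
  let _ : Algebra (MvPolynomial (Fin (n + 1)) K) (MvPolynomial (Fin n) K) :=
    (evalLastZero K n).toRingHom.toAlgebra
  rw [← map_evalLastZero_idealOfVars n]
  refine hasRegularSeq_quotient_iff_of_surjective
    (R := MvPolynomial (Fin (n + 1)) K) (R' := MvPolynomial (Fin n) K)
    (fun p => ⟨rename Fin.castSucc p, evalLastZero_rename p⟩) _ _ _ ?_ k
  ext p
  exact (mem_adjoinVar_iff I p).symm

lemma hasRegularSeq_mvPolynomial (n : ℕ) :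
    HasRegularSeq (idealOfVars (Fin n) K) (MvPolynomial (Fin n) K) n := by
  induction n with
  | zero => exact ⟨[], rfl, by simp, RingTheory.Sequence.IsRegular.nil _ _⟩
  | succ n ih =>
    have h1 : HasRegularSeq (idealOfVars (Fin n) K) (MvPolynomial (Fin n) K ⧸
        (⊥ : Ideal (MvPolynomial (Fin n) K))) n := by
      obtain ⟨rs, hl, hm, hr⟩ := ih
      exact ⟨rs, hl, hm, ((Submodule.quotEquivOfEqBot _ rfl).isRegular_congr rs).2 hr⟩
    rw [← hasRegularSeq_quotient_adjoinVar_iff] at h1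
    obtain ⟨rs, hl, hm, hr⟩ := h1
    refine ⟨X (Fin.last n) :: rs, by simpa using hl, ?_, ?_⟩
    · rintro r (_ | ⟨_, h⟩)
      · exact X_mem_idealOfVars _
      · exact hm r h
    · refine .cons ?_ ?_
      · exact (IsRegular.of_ne_zero (X_ne_zero _)).left.isSMulRegular
      · refine ((Submodule.quotEquivOfEq _ _ ?_).isRegular_congr rs).1 hr
        rw [← Submodule.ideal_span_singleton_smul]
        simp [adjoinVar, extIdeal]

lemma idealOfVars_ne_top (n : ℕ) :
    idealOfVars (Fin n) K ≠ ⊤ := by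
  intro h
  have : idealOfVars (Fin n) K ≤
      RingHom.ker (constantCoeff (R := K) (σ := Fin n)) := by
    rw [Ideal.span_le]
    rintro _ ⟨i, rfl⟩
    simp
  exact RingHom.ker_ne_top _ (top_le_iff.1 (h ▸ this))

lemma HasRegularSeq.le_of_mvPolynomial {n k : ℕ} {m : Ideal (MvPolynomial (Fin n) K)} {M : Type u}
    [AddCommGroup M] [Module (MvPolynomial (Fin n) K) M] [Module.Finite (MvPolynomial (Fin n) K) M]
    (h : HasRegularSeq m M k) : k ≤ n := by
  obtain ⟨rs, rfl, -, hr⟩ := h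
  have h1 := (length_le_supportDim_of_isRegular rs M hr).trans
    (Module.supportDim_le_ringKrullDim _ M)
  rw [MvPolynomial.ringKrullDim_of_isNoetherianRing, ringKrullDim_eq_zero_of_field] at h1
  simpa using h1

lemma HasRegularSeq.lt_of_quotient {n k : ℕ} {m I : Ideal (MvPolynomial (Fin n) K)} (hI : I ≠ ⊥)
    (h : HasRegularSeq m (MvPolynomial (Fin n) K ⧸ I) k) : k < n := by
  obtain ⟨rs, rfl, -, hr⟩ := h
  obtain ⟨f, hf, hf0⟩ := Submodule.exists_mem_ne_zero_of_ne_bot hI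
  have h1 := length_le_supportDim_of_isRegular rs _ hr
  rw [Module.supportDim_quotient_eq_ringKrullDim] at h1
  have h2 : ringKrullDim (MvPolynomial (Fin n) K ⧸ I) ≤
      ringKrullDim (MvPolynomial (Fin n) K ⧸ Ideal.span {f}) :=
    ringKrullDim_le_of_surjective (Ideal.Quotient.factor
      ((Ideal.span_singleton_le_iff_mem I).2 hf)) (Ideal.Quotient.factor_surjective _)
  have h3 := ringKrullDim_quotient_succ_le_of_nonZeroDivisor (mem_nonZeroDivisors_of_ne_zero hf0)
  rw [MvPolynomial.ringKrullDim_of_isNoetherianRing, ringKrullDim_eq_zero_of_field] at h3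
  have h4 : ((rs.length + 1 : ℕ) : WithBot ℕ∞) ≤ n := by
    push_cast
    refine le_trans ?_ (h3.trans (by simp))
    gcongr
    exact h1.trans h2
  exact_mod_cast h4

lemma adjoinVar_ne_bot {n : ℕ} (I : Ideal (MvPolynomial (Fin n) K)) : adjoinVar I ≠ ⊥ := by
  intro h
  have : (X (Fin.last n) : MvPolynomial (Fin (n + 1)) K) ∈ adjoinVar I := by
    rw [mem_adjoinVar_iff]; simp
  rw [h] at this
  exact X_ne_zero _ this

lemma adjoinVar_ne_top {n : ℕ} {I : Ideal (MvPolynomial (Fin n) K)} (h : I ≠ ⊤) :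
    adjoinVar I ≠ ⊤ := by
  rw [Ideal.ne_top_iff_one] at h ⊢
  rwa [mem_adjoinVar_iff, map_one]

lemma adjoinVar_le_idealOfVars {n : ℕ} {I : Ideal (MvPolynomial (Fin n) K)}
    (h : I ≤ idealOfVars (Fin n) K) : adjoinVar I ≤ idealOfVars (Fin (n + 1)) K := by
  refine sup_le (Ideal.map_le_iff_le_comap.2 (h.trans ?_)) ?_
  · rw [Ideal.span_le]
    rintro _ ⟨i, rfl⟩
    simpa using X_mem_idealOfVars i.castSucc
  · simpa [Ideal.span_le] using X_mem_idealOfVars (Fin.last n)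

lemma hasRegularSeq_adjoinVar_iff {n : ℕ} {I : Ideal (MvPolynomial (Fin n) K)} (hI : I ≠ ⊥)
    (hIm : I ≤ idealOfVars (Fin n) K) (k : ℕ) :
    HasRegularSeq (idealOfVars (Fin (n + 1)) K) (adjoinVar I) k ↔
      HasRegularSeq (idealOfVars (Fin n) K) I k := by
  cases k with
  | zero =>
    have := (Submodule.nontrivial_iff_ne_bot).2 hI
    have := (Submodule.nontrivial_iff_ne_bot).2 (adjoinVar_ne_bot I)
    exact iff_of_true ⟨[], rfl, by simp, .nil _ _⟩ ⟨[], rfl, by simp, .nil _ _⟩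
  | succ k =>
    have h1 (hk : k < n + 1) := (hasRegularSeq_ideal_succ_iff (idealOfVars_ne_top (n + 1))
      (adjoinVar_ne_bot I) (adjoinVar_le_idealOfVars hIm)
      (hasRegularSeq_mvPolynomial (n + 1)) hk).trans (hasRegularSeq_quotient_adjoinVar_iff I k)
    have h2 (hk : k < n) := hasRegularSeq_ideal_succ_iff (idealOfVars_ne_top n) hI hIm
      (hasRegularSeq_mvPolynomial n) hk
    constructor
    · intro h
      have h3 := (h1 h.le_of_mvPolynomial).1 h
      exact (h2 (h3.lt_of_quotient hI)).2 h3
    · intro h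
      have h3 := h.le_of_mvPolynomial
      exact (h1 (by lia)).2 ((h2 (by lia)).1 h)

lemma gradedDepth_eq_sSup {n : ℕ} (I : Ideal (MvPolynomial (Fin n) K)) :
    gradedDepth K n I = sSup ((↑) '' {k : ℕ | HasRegularSeq (idealOfVars (Fin n) K) I k}) := by
  unfold gradedDepth HasRegularSeq
  congr 1
  ext k
  constructor
  · rintro ⟨rs, rfl, h⟩
    exact ⟨rs.length, ⟨rs, rfl, h⟩, rfl⟩
  · rintro ⟨_, ⟨rs, rfl, h⟩, rfl⟩
    exact ⟨rs, rfl, h⟩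

lemma gradedDepth_adjoinVar {n : ℕ} {I : Ideal (MvPolynomial (Fin n) K)} (hI : I ≠ ⊥)
    (hIm : I ≤ idealOfVars (Fin n) K) :
    gradedDepth K (n + 1) (adjoinVar I) = gradedDepth K n I := by
  simp only [gradedDepth_eq_sSup, hasRegularSeq_adjoinVar_iff hI hIm]

lemma gradedDepth_le {n : ℕ} (I : Ideal (MvPolynomial (Fin n) K)) : gradedDepth K n I ≤ n := by
  rw [gradedDepth_eq_sSup]
  refine sSup_le ?_
  rintro _ ⟨k, hk, rfl⟩
  exact_mod_cast hk.le_of_mvPolynomial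

end Adjoin

section ConeDecomposition

variable {σ τ : Type*}

/-- The lattice points `a + w`, where `w` is supported on `Z`. -/
def cone (a : σ → ℕ) (Z : Finset σ) : Set (σ → ℕ) :=
  {u | ∀ i, a i ≤ u i ∧ (i ∉ Z → u i = a i)}

lemma mem_cone {a u : σ → ℕ} {Z : Finset σ} :
    u ∈ cone a Z ↔ ∀ i, a i ≤ u i ∧ (i ∉ Z → u i = a i) := .rfl

/-- The set `A` is a finite disjoint union of cones of dimension at least `d`. -/
def ConeDec (A : Set (σ → ℕ)) (d : ℕ) : Prop :=
  ∃ (ι : Type) (_ : Finite ι) (a : ι → σ → ℕ) (Z : ι → Finset σ),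
    (∀ i, d ≤ (Z i).card) ∧ (∀ i, cone (a i) (Z i) ⊆ A) ∧ ∀ u ∈ A, ∃! i, u ∈ cone (a i) (Z i)

lemma ConeDec.mono {A : Set (σ → ℕ)} {d e : ℕ} (h : ConeDec A d) (hed : e ≤ d) :
    ConeDec A e := by
  obtain ⟨ι, hι, a, Z, h1, h2⟩ := h
  exact ⟨ι, hι, a, Z, fun i => hed.trans (h1 i), h2⟩

lemma ConeDec.union {A B : Set (σ → ℕ)} {d : ℕ} (hA : ConeDec A d) (hB : ConeDec B d)
    (hAB : Disjoint A B) : ConeDec (A ∪ B) d := by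
  obtain ⟨ι, hι, a, Z, h1, h2, h3⟩ := hA
  obtain ⟨κ, hκ, b, Y, k1, k2, k3⟩ := hB
  refine ⟨ι ⊕ κ, inferInstance, Sum.elim a b, Sum.elim Z Y, ?_, ?_, ?_⟩
  · rintro (i | i)
    exacts [h1 i, k1 i]
  · rintro (i | i)
    exacts [(h2 i).trans Set.subset_union_left, (k2 i).trans Set.subset_union_right]
  · rintro u (hu | hu)
    · obtain ⟨i, hi, hi'⟩ := h3 u hu
      refine ⟨.inl i, hi, ?_⟩
      rintro (j | j) hj
      · exact congrArg _ (hi' j hj)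
      · exact (Set.disjoint_left.1 hAB hu (k2 j hj)).elim
    · obtain ⟨i, hi, hi'⟩ := k3 u hu
      refine ⟨.inr i, hi, ?_⟩
      rintro (j | j) hj
      · exact (Set.disjoint_left.1 hAB (h2 j hj) hu).elim
      · exact congrArg _ (hi' j hj)

lemma ConeDec.prod {A : Set (σ → ℕ)} {B : Set (τ → ℕ)} {d e : ℕ} (hA : ConeDec A d)
    (hB : ConeDec B e) :
    ConeDec {u : σ ⊕ τ → ℕ | u ∘ Sum.inl ∈ A ∧ u ∘ Sum.inr ∈ B} (d + e) := by
  obtain ⟨ι, hι, a, Z, h1, h2, h3⟩ := hA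
  obtain ⟨κ, hκ, b, Y, k1, k2, k3⟩ := hB
  have key (i : ι) (j : κ) (u : σ ⊕ τ → ℕ) :
      u ∈ cone (Sum.elim (a i) (b j)) ((Z i).disjSum (Y j)) ↔
        u ∘ Sum.inl ∈ cone (a i) (Z i) ∧ u ∘ Sum.inr ∈ cone (b j) (Y j) := by
    simp [mem_cone]
  refine ⟨ι × κ, inferInstance, fun p => Sum.elim (a p.1) (b p.2),
    fun p => (Z p.1).disjSum (Y p.2), fun p => ?_, fun p u hu => ?_, fun u hu => ?_⟩
  · rw [Finset.card_disjSum]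
    exact add_le_add (h1 _) (k1 _)
  · rw [key] at hu
    exact ⟨h2 _ hu.1, k2 _ hu.2⟩
  · obtain ⟨i, hi, hi'⟩ := h3 _ hu.1
    obtain ⟨j, hj, hj'⟩ := k3 _ hu.2
    refine ⟨(i, j), (key i j u).2 ⟨hi, hj⟩, ?_⟩
    rintro ⟨i₂, j₂⟩ h
    rw [key] at h
    exact Prod.ext (hi' _ h.1) (hj' _ h.2)

lemma ConeDec.reindex (e : σ ≃ τ) {A : Set (σ → ℕ)} {d : ℕ} (hA : ConeDec A d) :
    ConeDec {u : τ → ℕ | u ∘ e ∈ A} d := by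
  obtain ⟨ι, hι, a, Z, h1, h2, h3⟩ := hA
  have key (i : ι) (u : τ → ℕ) :
      u ∈ cone (a i ∘ e.symm) ((Z i).map e.toEmbedding) ↔ u ∘ e ∈ cone (a i) (Z i) := by
    rw [mem_cone, mem_cone, ← e.forall_congr_right]
    simp
  refine ⟨ι, hι, fun i => a i ∘ e.symm, fun i => (Z i).map e.toEmbedding, fun i => ?_,
    fun i u hu => h2 i ((key i u).1 hu), fun u hu => ?_⟩
  · simpa using h1 i
  · simpa only [key] using h3 _ hu

lemma coneDec_cone (a : σ → ℕ) (Z : Finset σ) : ConeDec (cone a Z) Z.card :=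
  ⟨Unit, inferInstance, fun _ => a, fun _ => Z, fun _ => le_rfl, fun _ => subset_rfl,
    fun _ hu => ⟨(), hu, fun _ _ => rfl⟩⟩

lemma coneDec_univ [Fintype σ] : ConeDec (Set.univ : Set (σ → ℕ)) (Fintype.card σ) := by
  have : (Set.univ : Set (σ → ℕ)) = cone 0 Finset.univ := by
    ext u
    simp [mem_cone]
  exact this ▸ coneDec_cone 0 Finset.univ

lemma coneDec_zero : ConeDec {u : σ → ℕ | u = 0} 0 := by
  have : {u : σ → ℕ | u = 0} = cone 0 ∅ := by
    ext u
    simp [mem_cone, funext_iff]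
  exact this ▸ coneDec_cone 0 ∅

lemma ConeDec.le_card [Fintype σ] {A : Set (σ → ℕ)} {d : ℕ} (h : ConeDec A d)
    (hA : A.Nonempty) : d ≤ Fintype.card σ := by
  obtain ⟨ι, hι, a, Z, h1, h2, h3⟩ := h
  obtain ⟨u, hu⟩ := hA
  obtain ⟨i, -⟩ := h3 u hu
  exact (h1 i).trans (Finset.card_le_univ _)

lemma coneDec_of_mem_iff_inf_mem [Finite σ] {A : Set (σ → ℕ)} (g : σ → ℕ)
    (h : ∀ u, u ∈ A ↔ u ⊓ g ∈ A) : ConeDec A 0 := by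
  classical
  have := Fintype.ofFinite σ
  have key (t u : σ → ℕ) (ht : t ≤ g) :
      u ∈ cone t (Finset.univ.filter fun i => t i = g i) ↔ u ⊓ g = t := by
    rw [mem_cone, funext_iff]
    refine forall_congr' fun i => ?_
    have := ht i
    simp only [Finset.mem_filter, Finset.mem_univ, true_and, Pi.inf_apply]
    lia
  have hfin : (Set.Iic g ∩ A).Finite := (Set.finite_Iic g).subset Set.inter_subset_left
  obtain ⟨m, ⟨f⟩⟩ := hfin.to_subtype.exists_equiv_fin
  refine ⟨Fin m, inferInstance, fun i => (f.symm i).1,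
    fun i => Finset.univ.filter fun j => (f.symm i).1 j = g j, fun _ => Nat.zero_le _,
    fun i u hu => ?_, fun u hu => ?_⟩
  · rw [key _ _ (f.symm i).2.1] at hu
    rw [h, hu]
    exact (f.symm i).2.2
  · refine ⟨f ⟨u ⊓ g, Set.mem_Iic.2 inf_le_right, (h u).1 hu⟩, ?_, fun j hj => ?_⟩
    · simp only [Equiv.symm_apply_apply]
      exact (key _ _ inf_le_right).2 rfl
    · have := (key _ _ (f.symm j).2.1).1 hj
      rw [← Equiv.symm_apply_eq]
      exact Subtype.ext this.symm

lemma IsUpperSet.exists_mem_iff_inf_mem [Finite σ] {A : Set (σ → ℕ)} (hA : IsUpperSet A) :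
    ∃ g : σ → ℕ, ∀ u, u ∈ A ↔ u ⊓ g ∈ A := by
  have hfin : {u | Minimal (· ∈ A) u}.Finite :=
    (setOfPred_minimal_antichain _).finite_of_partiallyWellOrderedOn
      (Set.isPWO_of_wellQuasiOrderedLE _)
  obtain ⟨g, hg⟩ := hfin.bddAbove
  refine ⟨g, fun u => ⟨fun hu => ?_, hA inf_le_left⟩⟩
  obtain ⟨m, hm, hmin⟩ := exists_minimal_le_of_wellFoundedLT (· ∈ A) u hu
  exact hA (le_inf hm (hg hmin)) hmin.prop

lemma IsUpperSet.coneDec [Finite σ] {A : Set (σ → ℕ)} (hA : IsUpperSet A) : ConeDec A 0 := by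
  obtain ⟨g, hg⟩ := hA.exists_mem_iff_inf_mem
  exact coneDec_of_mem_iff_inf_mem g hg

lemma IsUpperSet.coneDec_compl [Finite σ] {A : Set (σ → ℕ)} (hA : IsUpperSet A) :
    ConeDec Aᶜ 0 := by
  obtain ⟨g, hg⟩ := hA.exists_mem_iff_inf_mem
  exact coneDec_of_mem_iff_inf_mem g fun u => not_congr (hg u)

lemma ConeDec.reindex_ne_zero (e : σ ≃ τ) {d : ℕ} (h : ConeDec {u : σ → ℕ | u ≠ 0} d) :
    ConeDec {u : τ → ℕ | u ≠ 0} d := by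
  convert h.reindex e using 2
  ext u
  rw [Set.mem_ofPred_eq, ← e.surjective.injective_comp_right.ne_iff]
  rfl

lemma coneDec_fin_one_ne_zero : ConeDec {u : Fin 1 → ℕ | u ≠ 0} 1 := by
  have : {u : Fin 1 → ℕ | u ≠ 0} = cone 1 Finset.univ := by
    ext u
    simp [mem_cone, funext_iff, Nat.one_le_iff_ne_zero]
  exact this ▸ coneDec_cone 1 Finset.univ

/-- The nonzero vectors in three blocks, decomposed according to which blocks vanish. -/
lemma ConeDec.sum_ne_zero [Fintype σ] {d : ℕ} (h : ConeDec {u : σ → ℕ | u ≠ 0} d) (hd : 1 ≤ d)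
    (hσ : 1 ≤ Fintype.card σ) : ConeDec {u : σ ⊕ σ ⊕ σ → ℕ | u ≠ 0} (d + 1) := by
  have hu := coneDec_univ (σ := σ)
  have h0 := coneDec_zero (σ := σ)
  have h1 := (h.prod (hu.prod h0)).mono (show d + 1 ≤ _ by lia)
  have h2 := (h0.prod (h.prod hu)).mono (show d + 1 ≤ _ by lia)
  have h3 := (hu.prod (h0.prod h)).mono (show d + 1 ≤ _ by lia)
  have h4 := (h.prod (h.prod h)).mono (show d + 1 ≤ _ by lia)
  convert ((h1.union h2 ?_).union h3 ?_).union h4 ?_ using 1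
  · ext u
    have : u = 0 ↔ u ∘ Sum.inl = 0 ∧ (u ∘ Sum.inr) ∘ Sum.inl = 0 ∧
        (u ∘ Sum.inr) ∘ Sum.inr = 0 := by
      simp [funext_iff]
    simp only [Set.mem_ofPred_eq, Set.mem_union, Set.mem_univ, ne_eq, this]
    tauto
  all_goals
    rw [Set.disjoint_left]
    simp only [Set.mem_ofPred_eq, Set.mem_union, Set.mem_univ, ne_eq]
    tauto

/-- The Stanley depth of the maximal ideal grows without bound with the number of variables. -/
lemma exists_coneDec_ne_zero (d : ℕ) :
    ∃ k, d + 1 ≤ k ∧ ConeDec {u : Fin k → ℕ | u ≠ 0} (d + 1) := by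
  induction d with
  | zero => exact ⟨1, le_rfl, coneDec_fin_one_ne_zero⟩
  | succ d ih =>
    obtain ⟨k, hk, h⟩ := ih
    refine ⟨_, ?_, (h.sum_ne_zero (by lia) (by simp; lia)).reindex_ne_zero (Fintype.equivFin _)⟩
    simp only [Fintype.card_sum, Fintype.card_fin]
    lia

lemma ConeDec.snoc_zero {n d : ℕ} {A : Set (Fin (n + 1) → ℕ)} (h : ConeDec A (d + 1)) :
    ConeDec {u : Fin n → ℕ | Fin.snoc (α := fun _ => ℕ) u 0 ∈ A} d := by
  obtain ⟨ι, hι, a, Z, h1, h2, h3⟩ := h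
  have key (i : ι) (hi : a i (Fin.last n) = 0) (u : Fin n → ℕ) :
      u ∈ cone (a i ∘ Fin.castSucc) (Finset.univ.filter fun j => j.castSucc ∈ Z i) ↔
        Fin.snoc (α := fun _ => ℕ) u 0 ∈ cone (a i) (Z i) := by
    simp [mem_cone, Fin.forall_fin_succ', hi]
  refine ⟨{i // a i (Fin.last n) = 0}, inferInstance, fun i => a i ∘ Fin.castSucc,
    fun i => Finset.univ.filter fun j => j.castSucc ∈ Z i, fun i => ?_,
    fun i u hu => h2 i ((key i i.2 u).1 hu), fun u hu => ?_⟩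
  · have : Z i ⊆ insert (Fin.last n)
        ((Finset.univ.filter fun j => j.castSucc ∈ Z i).map Fin.castSuccEmb) := by
      intro j
      induction j using Fin.lastCases <;> simp
    have := (h1 i).trans ((Finset.card_le_card this).trans (Finset.card_insert_le _ _))
    simpa using this
  · obtain ⟨i, hi, hi'⟩ := h3 _ hu
    have hz : a i (Fin.last n) = 0 := by simpa using (hi (Fin.last n)).1
    refine ⟨⟨i, hz⟩, (key i hz u).2 hi, fun j hj => ?_⟩
    exact Subtype.ext (hi' j ((key j j.2 u).1 hj))

lemma ConeDec.append {n k d e : ℕ} {A : Set (Fin n → ℕ)} {B : Set (Fin k → ℕ)}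
    (hA : ConeDec A d) (hB : ConeDec B e) :
    ConeDec {u : Fin (n + k) → ℕ | u ∘ Fin.castAdd k ∈ A ∧ u ∘ Fin.natAdd n ∈ B} (d + e) := by
  convert (hA.prod hB).reindex finSumFinEquiv using 1
  ext u
  have h1 : (u ∘ finSumFinEquiv) ∘ Sum.inl = u ∘ Fin.castAdd k := by ext; simp
  have h2 : (u ∘ finSumFinEquiv) ∘ Sum.inr = u ∘ Fin.natAdd n := by ext; simp
  simp [h1, h2]

lemma ConeDec.append_or_ne_zero {n k d : ℕ} {A : Set (Fin n → ℕ)} (hA : IsUpperSet A)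
    (hk : ConeDec {u : Fin k → ℕ | u ≠ 0} d) (hdk : d ≤ k) :
    ConeDec {u : Fin (n + k) → ℕ | u ∘ Fin.castAdd k ∈ A ∨ u ∘ Fin.natAdd n ≠ 0} d := by
  have h1 := (hA.coneDec.append (coneDec_univ (σ := Fin k))).mono (show d ≤ _ by simpa using hdk)
  have h2 := (hA.coneDec_compl.append hk).mono (show d ≤ _ by lia)
  convert h1.union h2 ?_ using 1
  · ext u
    simp only [Set.mem_ofPred_eq, Set.mem_union, Set.mem_univ, Set.mem_compl_iff]
    tauto
  · rw [Set.disjoint_left]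
    simp only [Set.mem_ofPred_eq, Set.mem_univ, Set.mem_compl_iff]
    tauto

lemma ConeDec.castSucc_or_last_ne_zero {n d : ℕ} {A : Set (Fin n → ℕ)} (hA : ConeDec A d)
    (hdn : d ≤ n) :
    ConeDec {u : Fin (n + 1) → ℕ | u ∘ Fin.castSucc ∈ A ∨ u (Fin.last n) ≠ 0} d := by
  have h1 := (hA.append (coneDec_zero (σ := Fin 1))).mono (show d ≤ _ from le_rfl)
  have h2 := ((coneDec_univ (σ := Fin n)).append coneDec_fin_one_ne_zero).mono
    (show d ≤ _ by simp; lia)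
  convert h1.union h2 ?_ using 1
  · ext u
    have : u ∘ Fin.natAdd n = (0 : Fin 1 → ℕ) ↔ u (Fin.last n) = 0 := by
      simp only [funext_iff, Fin.forall_fin_one]
      rfl
    simp only [Set.mem_ofPred_eq, Set.mem_union, Set.mem_univ, ne_eq, this]
    have : u ∘ Fin.castAdd 1 = u ∘ Fin.castSucc := rfl
    rw [this]
    tauto
  · rw [Set.disjoint_left]
    simp only [Set.mem_ofPred_eq, Set.mem_univ]
    tauto

end ConeDecomposition

section ExponentSet

variable {K : Type*} [Field K]

lemma iSup_restrictSupport {σ : Type*} {ι : Sort*} (s : ι → Set (σ →₀ ℕ)) :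
    ⨆ i, restrictSupport K (s i) = restrictSupport K (⋃ i, s i) := by
  simp only [restrictSupport_eq_span, Set.image_iUnion, Submodule.span_iUnion]

lemma restrictSupport_le_iff {σ : Type*} {s t : Set (σ →₀ ℕ)} :
    restrictSupport K s ≤ restrictSupport K t ↔ s ⊆ t := by
  refine ⟨fun h c hc => ?_, restrictSupport_mono K⟩
  have := h ((monomial_mem_restrictSupport K).2 (.inl hc) : monomial c (1 : K) ∈ _)
  simpa using this

lemma disjoint_restrictSupport_iff {σ : Type*} {s t : Set (σ →₀ ℕ)} :
    Disjoint (restrictSupport K s) (restrictSupport K t) ↔ Disjoint s t := by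
  rw [Submodule.disjoint_def, Set.disjoint_left]
  constructor
  · intro h c hs ht
    exact one_ne_zero (monomial_eq_zero.1 (h (monomial c (1 : K))
      ((monomial_mem_restrictSupport K).2 (.inl hs)) ((monomial_mem_restrictSupport K).2 (.inl ht))))
  · intro h p hs ht
    rw [← support_eq_empty, Finset.eq_empty_iff_forall_notMem]
    exact fun c hc => h (hs hc) (ht hc)

lemma iSupIndep_restrictSupport_iff {σ ι : Type*} {s : ι → Set (σ →₀ ℕ)} :
    iSupIndep (fun i => restrictSupport K (s i)) ↔ ∀ i j c, c ∈ s i → c ∈ s j → i = j := by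
  have h (i : ι) : ⨆ (j) (_ : j ≠ i), restrictSupport K (s j) =
      restrictSupport K (⋃ (j) (_ : j ≠ i), s j) := by
    rw [← iSup_restrictSupport]
    exact iSup_congr fun j => iSup_restrictSupport _
  have h' (i : ι) : Disjoint (restrictSupport K (s i))
      (⨆ (j) (_ : j ≠ i), restrictSupport K (s j)) ↔
      ∀ c ∈ s i, ∀ j, c ∈ s j → i = j := by
    rw [h, disjoint_restrictSupport_iff, Set.disjoint_left]
    simp only [Set.mem_iUnion, not_exists]
    grind
  refine (forall_congr' h').trans ?_
  grind

/-- The exponent vectors of the monomials in `I`. -/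
def exponentSet {n : ℕ} (I : Ideal (MvPolynomial (Fin n) K)) : Set (Fin n → ℕ) :=
  {u | monomial (Finsupp.equivFunOnFinite.symm u) (1 : K) ∈ I}

lemma mem_exponentSet {n : ℕ} {I : Ideal (MvPolynomial (Fin n) K)} {c : Fin n →₀ ℕ} :
    ⇑c ∈ exponentSet I ↔ monomial c (1 : K) ∈ I := by
  simp [exponentSet]

lemma isUpperSet_exponentSet {n : ℕ} (I : Ideal (MvPolynomial (Fin n) K)) :
    IsUpperSet (exponentSet I) := by
  intro u v huv hu
  have : monomial (Finsupp.equivFunOnFinite.symm v) (1 : K) =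
      monomial (Finsupp.equivFunOnFinite.symm (v - u)) 1 *
        monomial (Finsupp.equivFunOnFinite.symm u) 1 := by
    rw [monomial_mul, one_mul]
    congr
    ext i
    simp [huv i]
  rw [exponentSet, Set.mem_ofPred_eq, this]
  exact I.mul_mem_left _ hu

lemma stanleySpace_eq_restrictSupport {n : ℕ} (a : Fin n →₀ ℕ) (Z : Finset (Fin n)) :
    StanleySpace K a Z = restrictSupport K {c | ⇑c ∈ cone a Z} := by
  rw [StanleySpace, restrictSupport_eq_span]
  congr 1
  ext p
  constructor
  · rintro ⟨c, hc, rfl⟩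
    refine ⟨a + c, fun i => ?_, rfl⟩
    simpa using fun hi => Finsupp.notMem_support_iff.1 fun h => hi (hc h)
  · rintro ⟨c, hc, rfl⟩
    refine ⟨c - a, fun i hi => ?_, ?_⟩
    · by_contra h
      simp [(hc i).2 h] at hi
    · rw [add_tsub_cancel_of_le fun i => (hc i).1]

lemma monomialSpan_bot_eq_restrictSupport {n : ℕ} (I : Ideal (MvPolynomial (Fin n) K)) :
    monomialSpan K I ⊥ = restrictSupport K {c | ⇑c ∈ exponentSet I} := by
  rw [monomialSpan, restrictSupport_eq_span]
  congr 1
  ext p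
  simp only [Set.mem_ofPred_eq, Set.mem_image, mem_exponentSet, Ideal.mem_bot, monomial_eq_zero,
    one_ne_zero, not_false_eq_true, and_true]
  exact exists_congr fun c => and_comm.trans (and_congr_right' eq_comm)

lemma isStanleyDecomp_bot_iff {n r : ℕ} {I : Ideal (MvPolynomial (Fin n) K)}
    {a : Fin r → Fin n →₀ ℕ} {Z : Fin r → Finset (Fin n)} :
    IsStanleyDecomp K I ⊥ a Z ↔ (∀ i, cone (a i) (Z i) ⊆ exponentSet I) ∧
      ∀ u ∈ exponentSet I, ∃! i, u ∈ cone (a i) (Z i) := by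
  simp only [IsStanleyDecomp, stanleySpace_eq_restrictSupport, monomialSpan_bot_eq_restrictSupport,
    iSup_restrictSupport, iSupIndep_restrictSupport_iff]
  rw [le_antisymm_iff, restrictSupport_le_iff, restrictSupport_le_iff]
  have hf (P : (Fin n → ℕ) → Prop) : (∀ u, P u) ↔ ∀ c : Fin n →₀ ℕ, P c :=
    (Finsupp.equivFunOnFinite.forall_congr_right).symm
  simp only [Set.subset_def, hf, Set.mem_iUnion, Set.mem_ofPred_eq]
  constructor
  · rintro ⟨h1, h2, h3⟩
    refine ⟨fun i c hc => h2 c ⟨i, hc⟩, fun c hc => ?_⟩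
    obtain ⟨i, hi⟩ := h3 c hc
    exact ⟨i, hi, fun j hj => h1 j i c hj hi⟩
  · rintro ⟨h1, h2⟩
    refine ⟨fun i j c hi hj => (h2 c (h1 i c hi)).unique hi hj, ?_, fun c hc => (h2 c hc).exists⟩
    rintro c ⟨i, hi⟩
    exact h1 i c hi

lemma exists_isStanleyDecomp_iff {n d : ℕ} {I : Ideal (MvPolynomial (Fin n) K)} :
    (∃ (r : ℕ) (a : Fin r → Fin n →₀ ℕ) (Z : Fin r → Finset (Fin n)),
      IsStanleyDecomp K I ⊥ a Z ∧ ∀ i, d ≤ (Z i).card) ↔ ConeDec (exponentSet I) d := by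
  simp only [isStanleyDecomp_bot_iff]
  constructor
  · rintro ⟨r, a, Z, ⟨h1, h2⟩, h⟩
    exact ⟨Fin r, inferInstance, fun i => a i, Z, h, h1, h2⟩
  · rintro ⟨ι, hι, a, Z, h, h1, h2⟩
    obtain ⟨r, ⟨e⟩⟩ := hι.exists_equiv_fin
    refine ⟨r, fun i => Finsupp.equivFunOnFinite.symm (a (e.symm i)), fun i => Z (e.symm i),
      ⟨fun i => ?_, fun u hu => ?_⟩, fun i => h _⟩
    · simpa using h1 _
    · obtain ⟨i, hi, hi'⟩ := h2 u hu
      refine ⟨e i, by simpa using hi, fun j hj => ?_⟩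
      rw [← Equiv.symm_apply_eq]
      exact hi' _ (by simpa using hj)

lemma le_sdepth_iff {n d : ℕ} {I : Ideal (MvPolynomial (Fin n) K)} :
    (d : ℕ∞) ≤ sdepth K I ⊥ ↔ ConeDec (exponentSet I) d := by
  constructor
  · intro h
    cases d with
    | zero => exact (isUpperSet_exponentSet I).coneDec
    | succ d =>
      have h1 : (d : ℕ∞) < sdepth K I ⊥ := lt_of_lt_of_le (by exact_mod_cast d.lt_succ_self) h
      obtain ⟨e, ⟨r, a, Z, hZ, he⟩, hde⟩ := lt_sSup_iff.1 h1
      refine exists_isStanleyDecomp_iff.1 ⟨r, a, Z, hZ, fun i => ?_⟩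
      exact_mod_cast hde.trans_le (he i)
  · intro h
    obtain ⟨r, a, Z, hZ, hd⟩ := exists_isStanleyDecomp_iff.2 h
    exact le_sSup ⟨r, a, Z, hZ, fun i => by exact_mod_cast hd i⟩

end ExponentSet

section Iterate

universe u

variable {K : Type u} [Field K]

lemma IsMonomialIdeal.adjoinVar {n : ℕ} {I : Ideal (MvPolynomial (Fin n) K)}
    (hI : IsMonomialIdeal I) : IsMonomialIdeal (adjoinVar I) := by
  obtain ⟨G, rfl⟩ := hI
  refine ⟨Finsupp.mapDomain Fin.castSucc '' G ∪ {Finsupp.single (Fin.last n) 1}, ?_⟩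
  rw [_root_.adjoinVar, extIdeal, Ideal.map_span, ← Ideal.span_union, Set.image_union,
    Set.image_image, Set.image_image, Set.image_singleton]
  simp only [rename_monomial, X]

lemma IsMonomialIdeal.le_idealOfVars {n : ℕ} {I : Ideal (MvPolynomial (Fin n) K)}
    (hI : IsMonomialIdeal I) (h : I ≠ ⊤) : I ≤ idealOfVars (Fin n) K := by
  obtain ⟨G, rfl⟩ := hI
  rw [Ideal.span_le]
  rintro _ ⟨c, hc, rfl⟩
  rw [SetLike.mem_coe, ← pow_one (idealOfVars _ _),
    monomial_mem_pow_idealOfVars_iff _ _ one_ne_zero, Nat.one_le_iff_ne_zero, ne_eq,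
    Finsupp.degree_eq_zero_iff]
  rintro rfl
  exact h ((Ideal.eq_top_iff_one _).2 (Ideal.subset_span ⟨0, hc, rfl⟩))

lemma IsMonomialIdeal.exponentSet_nonempty {n : ℕ} {I : Ideal (MvPolynomial (Fin n) K)}
    (hI : IsMonomialIdeal I) (h : I ≠ ⊥) : (exponentSet I).Nonempty := by
  obtain ⟨G, rfl⟩ := hI
  obtain ⟨c, hc⟩ : G.Nonempty := by
    rw [Set.nonempty_iff_ne_empty]
    rintro rfl
    simp at h
  exact ⟨c, mem_exponentSet.2 (Ideal.subset_span ⟨c, hc, rfl⟩)⟩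

lemma evalLastZero_monomial {n : ℕ} (u : Fin (n + 1) → ℕ) :
    evalLastZero K n (monomial (Finsupp.equivFunOnFinite.symm u) 1) =
      if u (Fin.last n) = 0 then monomial (Finsupp.equivFunOnFinite.symm (u ∘ Fin.castSucc)) 1
      else 0 := by
  rw [evalLastZero, aeval_monomial, Finsupp.prod_fintype _ _ (by simp), Fin.prod_univ_castSucc]
  split_ifs with h
  · simp [h, monomial_eq, Finsupp.prod_fintype]
  · simp [h]

lemma mem_exponentSet_adjoinVar_iff {n : ℕ} {I : Ideal (MvPolynomial (Fin n) K)}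
    {u : Fin (n + 1) → ℕ} :
    u ∈ exponentSet (adjoinVar I) ↔ u ∘ Fin.castSucc ∈ exponentSet I ∨ u (Fin.last n) ≠ 0 := by
  rw [exponentSet, Set.mem_ofPred_eq, mem_adjoinVar_iff, evalLastZero_monomial]
  split_ifs with h <;> simp [h, exponentSet]

lemma sdepth_le_sdepth_adjoinVar {n : ℕ} {I : Ideal (MvPolynomial (Fin n) K)}
    (hI : IsMonomialIdeal I) (h : I ≠ ⊥) : sdepth K I ⊥ ≤ sdepth K (adjoinVar I) ⊥ := by
  refine ENat.forall_natCast_le_iff_le.1 fun d hd => ?_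
  rw [le_sdepth_iff] at hd ⊢
  have hdn : d ≤ n := by simpa using hd.le_card (hI.exponentSet_nonempty h)
  convert hd.castSucc_or_last_ne_zero hdn using 1
  ext u
  exact mem_exponentSet_adjoinVar_iff

lemma sdepth_adjoinVar_le {n : ℕ} (I : Ideal (MvPolynomial (Fin n) K)) :
    sdepth K (adjoinVar I) ⊥ ≤ sdepth K I ⊥ + 1 := by
  refine ENat.forall_natCast_le_iff_le.1 fun d hd => ?_
  cases d with
  | zero => simp
  | succ d =>
    push_cast
    gcongr
    rw [le_sdepth_iff] at hd ⊢
    convert hd.snoc_zero using 1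
    ext u
    simp [mem_exponentSet_adjoinVar_iff]

/-- The ideal `(I, y₁, …, yₖ)` of `S[y₁, …, yₖ]`. -/
noncomputable def adjoinVars {n : ℕ} (I : Ideal (MvPolynomial (Fin n) K)) :
    (k : ℕ) → Ideal (MvPolynomial (Fin (n + k)) K)
  | 0 => I
  | k + 1 => adjoinVar (adjoinVars I k)

lemma mem_exponentSet_adjoinVars_iff {n k : ℕ} {I : Ideal (MvPolynomial (Fin n) K)}
    {u : Fin (n + k) → ℕ} : u ∈ exponentSet (adjoinVars I k) ↔
      u ∘ Fin.castAdd k ∈ exponentSet I ∨ u ∘ Fin.natAdd n ≠ 0 := by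
  induction k with
  | zero =>
    have : u ∘ Fin.natAdd n = 0 := Subsingleton.elim _ _
    simp only [this, ne_eq, not_true_eq_false, or_false]
    rfl
  | succ k ih =>
    have h1 : u ∘ Fin.natAdd n = 0 ↔
        (u ∘ Fin.castSucc) ∘ Fin.natAdd n = (0 : Fin k → ℕ) ∧ u (Fin.last (n + k)) = 0 := by
      simp only [funext_iff, Fin.forall_fin_succ']
      rfl
    refine mem_exponentSet_adjoinVar_iff.trans ?_
    rw [ih, or_assoc, ne_eq (u ∘ Fin.natAdd n), h1, not_and_or]
    rfl

lemma IsMonomialIdeal.adjoinVars {n : ℕ} {I : Ideal (MvPolynomial (Fin n) K)}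
    (hI : IsMonomialIdeal I) (k : ℕ) : IsMonomialIdeal (adjoinVars I k) := by
  induction k with
  | zero => exact hI
  | succ k ih => exact ih.adjoinVar

lemma adjoinVars_ne_bot {n : ℕ} {I : Ideal (MvPolynomial (Fin n) K)} (hI : I ≠ ⊥) (k : ℕ) :
    adjoinVars I k ≠ ⊥ := by
  cases k with
  | zero => exact hI
  | succ k => exact adjoinVar_ne_bot _

lemma adjoinVars_ne_top {n : ℕ} {I : Ideal (MvPolynomial (Fin n) K)} (hI : I ≠ ⊤) (k : ℕ) :
    adjoinVars I k ≠ ⊤ := by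
  induction k with
  | zero => exact hI
  | succ k ih => exact adjoinVar_ne_top ih

lemma gradedDepth_adjoinVars {n : ℕ} {I : Ideal (MvPolynomial (Fin n) K)}
    (hI : IsMonomialIdeal I) (h0 : I ≠ ⊥) (h1 : I ≠ ⊤) (k : ℕ) :
    gradedDepth K (n + k) (adjoinVars I k) = gradedDepth K n I := by
  induction k with
  | zero => rfl
  | succ k ih =>
    exact (gradedDepth_adjoinVar (adjoinVars_ne_bot h0 k)
      ((hI.adjoinVars k).le_idealOfVars (adjoinVars_ne_top h1 k))).trans ih

lemma exists_le_sdepth_adjoinVars {n : ℕ} (I : Ideal (MvPolynomial (Fin n) K)) (d : ℕ) :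
    ∃ k, (d : ℕ∞) ≤ sdepth K (adjoinVars I k) ⊥ := by
  obtain ⟨k, hk, h⟩ := exists_coneDec_ne_zero d
  refine ⟨k, le_sdepth_iff.2 ?_⟩
  convert (ConeDec.append_or_ne_zero (isUpperSet_exponentSet I) h hk).mono d.le_succ using 1
  ext u
  exact mem_exponentSet_adjoinVars_iff

end Iterate

/-- The following are equivalent:
(1) for every `n ≥ 1` and every monomial ideal `I ⊂ S = K[x_1,…,x_n]` one has
`sdepth_S(I) ≥ depth_S(I)`;
(2) for every `n ≥ 1` and every monomial ideal `I ⊂ S = K[x_1,…,x_n]`, setting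
`S̄ = S[y]`, the equality `sdepth_{S̄}((I, y)) = depth_S(I)` implies
`sdepth_S(I) = depth_S(I)`. -/
theorem stanley_conjecture_ideals_iff {K : Type*} [Field K] :
    (∀ (n : ℕ), 1 ≤ n → ∀ I : Ideal (MvPolynomial (Fin n) K),
      IsMonomialIdeal I → I ≠ ⊥ → I ≠ ⊤ → sdepth K I ⊥ ≥ gradedDepth K n ↥I) ↔
    (∀ (n : ℕ), 1 ≤ n → ∀ I : Ideal (MvPolynomial (Fin n) K),
      IsMonomialIdeal I → I ≠ ⊥ → I ≠ ⊤ →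
      sdepth K (extIdeal Fin.castSucc I ⊔
          Ideal.span {MvPolynomial.X (Fin.last n)}) ⊥ = gradedDepth K n ↥I →
      sdepth K I ⊥ = gradedDepth K n ↥I) := by
  constructor
  · intro h n hn I hI h0 h1 hs
    exact le_antisymm ((sdepth_le_sdepth_adjoinVar hI h0).trans hs.le) (h n hn I hI h0 h1)
  · intro h n hn I hI h0 h1
    by_contra! hlt
    have key (k : ℕ) : sdepth K (adjoinVars I k) ⊥ < gradedDepth K n I := by
      induction k with
      | zero => exact hlt
      | succ k ih =>
        refine lt_of_le_of_ne ((sdepth_adjoinVar_le _).trans (Order.add_one_le_of_lt ih)) ?_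
        rw [← gradedDepth_adjoinVars hI h0 h1 k] at ih ⊢
        exact fun hk => ih.ne (h (n + k) (by lia) _ (hI.adjoinVars k) (adjoinVars_ne_bot h0 k)
          (adjoinVars_ne_top h1 k) hk)
    obtain ⟨k, hk⟩ := exists_le_sdepth_adjoinVars I n
    exact ((key k).trans_le (gradedDepth_le I)).not_ge hk
end
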